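/- arXiv:2403.18075 — 7 statements merged into one kernel-verified Lean document; each statement's English description precedes it below -/
import Mathlib

section
/- Let d be an even positive integer and s = (s_1,…,s_d) a tuple of positive integers of weight |s| = s_1+⋯+s_d. Then for every odd prime p, T_p(s_d,…,s_1) = (−1)^{|s|} · T_p(s_1,…,s_d) and S_p(s_d,…,s_1) = (−1)^{|s|} · S_p(s_1,…,s_d) in ℤ/pℤ. -/
open scoped Classical

/-- Finite multiple T-sum `T_p(s₁,…,s_d)`: the sum over
`p > n₁ > ⋯ > n_d > 0` with `n_j ≡ d−j+1 (mod 2)` of `∏ n_j^{−s_j}` in `ℤ/pℤ`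
(indices written 0-based, so the parity condition reads `n_j ≡ d−j (mod 2)`). -/
noncomputable def TsumP (p : ℕ) (s : List ℕ) : ZMod p :=
  ∑ n : Fin s.length → Fin p,
    if (∀ j, 0 < (n j : ℕ)) ∧ (∀ i j : Fin s.length, i < j → (n j : ℕ) < (n i : ℕ)) ∧
       (∀ j : Fin s.length, (n j : ℕ) % 2 = (s.length - (j : ℕ)) % 2)
    then ∏ j, (((n j : ℕ) : ZMod p) ^ s.get j)⁻¹
    else 0

/-- Finite multiple S-sum `S_p(s₁,…,s_d)`: as `T_p` but with the parity
condition `n_j ≡ d−j (mod 2)` (1-based), i.e. `n_j ≡ d−1−j (mod 2)` 0-based. -/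
noncomputable def SsumP (p : ℕ) (s : List ℕ) : ZMod p :=
  ∑ n : Fin s.length → Fin p,
    if (∀ j, 0 < (n j : ℕ)) ∧ (∀ i j : Fin s.length, i < j → (n j : ℕ) < (n i : ℕ)) ∧
       (∀ j : Fin s.length, (n j : ℕ) % 2 = (s.length - 1 - (j : ℕ)) % 2)
    then ∏ j, (((n j : ℕ) : ZMod p) ^ s.get j)⁻¹
    else 0

/-- The substitution `n_j ↦ p - n_{d-1-j}` in a sum over decreasing tuples with prescribed
parities: it reverses the exponents and flips the parity conditions. -/
theorem sum_decreasing_reverse (s : List ℕ) (p : ℕ) [Fact p.Prime] (hodd : p % 2 = 1) (q' q : ℕ → ℕ)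
    (hq : ∀ j < s.length, (q' j + q (s.length - 1 - j)) % 2 = 1) :
    (∑ n : Fin s.reverse.length → Fin p,
      if (∀ j, 0 < (n j : ℕ)) ∧
         (∀ i j : Fin s.reverse.length, i < j → (n j : ℕ) < (n i : ℕ)) ∧
         (∀ j : Fin s.reverse.length, (n j : ℕ) % 2 = q' j % 2)
      then ∏ j, (((n j : ℕ) : ZMod p) ^ s.reverse.get j)⁻¹
      else 0) =
    (-1 : ZMod p) ^ s.sum * ∑ n : Fin s.length → Fin p,
      if (∀ j, 0 < (n j : ℕ)) ∧ (∀ i j : Fin s.length, i < j → (n j : ℕ) < (n i : ℕ)) ∧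
         (∀ j : Fin s.length, (n j : ℕ) % 2 = q j % 2)
      then ∏ j, (((n j : ℕ) : ZMod p) ^ s.get j)⁻¹
      else 0 := by
  have hlen : s.length = s.reverse.length := List.length_reverse.symm
  let e : Fin s.length ≃ Fin s.reverse.length := Fin.revPerm.trans (finCongr hlen)
  have he : ∀ j, (e j : ℕ) = s.length - 1 - j := fun j => by
    simp [e, Fin.val_rev]; omega
  have hval : ∀ x : Fin p, 0 < (x : ℕ) → ((-x : Fin p) : ℕ) = p - x := fun x hx => by
    rw [Fin.val_neg', Nat.mod_eq_of_lt (by omega)]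
  have hzero : ∀ x : Fin p, 0 < ((-x : Fin p) : ℕ) ↔ 0 < (x : ℕ) := fun x => by
    simp only [Fin.val_pos_iff, Fin.pos_iff_ne_zero, ne_eq, neg_eq_zero]
  rw [Finset.mul_sum]
  symm
  refine Fintype.sum_equiv (e.arrowCongr (Equiv.neg (Fin p))) _ _ fun n => ?_
  set m := e.arrowCongr (Equiv.neg (Fin p)) n with hm
  have hme : ∀ j, m (e j) = -n j := fun j => by simp [hm]
  have hpos : (∀ j, 0 < (m j : ℕ)) ↔ ∀ j, 0 < (n j : ℕ) := by
    simp only [← e.forall_congr_right, hme, hzero]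
  by_cases h0 : ∀ j, 0 < (n j : ℕ)
  swap
  · rw [if_neg fun h => h0 h.1, if_neg fun h => h0 (hpos.1 h.1), mul_zero]
  have hmv : ∀ j, (m (e j) : ℕ) = p - n j := fun j => by rw [hme, hval _ (h0 j)]
  have hlt : (∀ i j, i < j → (m j : ℕ) < m i) ↔ ∀ i j, i < j → (n j : ℕ) < n i := by
    have hrev : ∀ i j, e i < e j ↔ j < i := fun i j => by
      rw [Fin.lt_def, Fin.lt_def, he, he]; omega
    have key : ∀ i j, (m (e j) : ℕ) < m (e i) ↔ (n i : ℕ) < n j := fun i j => by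
      rw [hmv, hmv]; omega
    constructor
    · intro h i j hij
      exact (key j i).1 (h _ _ ((hrev j i).2 hij))
    · intro h i j hij
      obtain ⟨i, rfl⟩ := e.surjective i
      obtain ⟨j, rfl⟩ := e.surjective j
      exact (key i j).2 (h _ _ ((hrev i j).1 hij))
  have hpar : (∀ j, (m j : ℕ) % 2 = q' j % 2) ↔ ∀ j, (n j : ℕ) % 2 = q j % 2 := by
    rw [← e.forall_congr_right]
    refine forall_congr' fun j => ?_
    have hj := hq (s.length - 1 - j) (by omega)
    rw [show s.length - 1 - (s.length - 1 - (j : ℕ)) = j by omega] at hj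
    rw [hmv, he]
    omega
  simp only [hpos, hlt, hpar]
  split_ifs
  · rw [← e.prod_comp]
    have hsum : s.sum = ∑ j, s.get j := by rw [← List.sum_ofFn, List.ofFn_get]
    rw [hsum, ← Finset.prod_pow_eq_pow_sum, ← Finset.prod_mul_distrib]
    refine Finset.prod_congr rfl fun j _ => ?_
    have hget : s.reverse.get (e j) = s.get j := by
      simp only [List.get_eq_getElem, List.getElem_reverse, he]
      congr 1
      omega
    rw [hget, hmv, Nat.cast_sub (n j).is_lt.le, ZMod.natCast_self, zero_sub, neg_pow ((n j : ℕ) : ZMod p),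
      mul_inv, ← inv_pow (-1 : ZMod p), inv_neg_one]
  · simp

/-- Reversal relations in even depth: for `d` even positive, `s ∈ ℕ₊^d`, and every
odd prime `p`, `T_p(←s) = (−1)^{|s|} T_p(s)` and `S_p(←s) = (−1)^{|s|} S_p(s)`. -/
theorem reversal_even_depth (s : List ℕ) (hpos : ∀ x ∈ s, 0 < x)
    (hne : s ≠ []) (heven : Even s.length)
    (p : ℕ) (hp : p.Prime) (hp2 : p ≠ 2) :
    TsumP p s.reverse = (-1 : ZMod p) ^ s.sum * TsumP p s ∧
    SsumP p s.reverse = (-1 : ZMod p) ^ s.sum * SsumP p s := by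
  have : Fact p.Prime := ⟨hp⟩
  have hodd : p % 2 = 1 := hp.eq_two_or_odd.resolve_left hp2
  have hlen : s.reverse.length = s.length := List.length_reverse
  have hd := Nat.even_iff.1 heven
  constructor
  · refine sum_decreasing_reverse s p hodd (s.reverse.length - ·) (s.length - ·) fun j hj => ?_
    omega
  · refine sum_decreasing_reverse s p hodd (s.reverse.length - 1 - ·) (s.length - 1 - ·)
      fun j hj => ?_
    omega
end

section
/- Let d be an odd positive integer and s = (s_1,…,s_d) a tuple of positive integers of weight |s| = s_1+⋯+s_d. Then for every odd prime p, T_p(s_d,…,s_1) = (−1)^{|s|} · S_p(s_1,…,s_d) and S_p(s_d,…,s_1) = (−1)^{|s|} · T_p(s_1,…,s_d) in ℤ/pℤ. -/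
open scoped Classical

/-- The substitution `n ↦ p - n` in a parity-restricted multiple harmonic sum modulo an odd
prime: it reverses the order of the indices and flips all parity conditions. -/
theorem sum_parity_reflect {p d d' : ℕ} (hp : p.Prime) (hp2 : p ≠ 2) (e : Fin d' ≃ Fin d)
    (he : ∀ i j, e i < e j ↔ j < i) (s : Fin d → ℕ) (s' : Fin d' → ℕ)
    (hs : ∀ i, s' i = s (e i)) (a : Fin d → ℕ) (a' : Fin d' → ℕ)
    (ha : ∀ i, a' i % 2 = (a (e i) + 1) % 2) :
    (∑ n : Fin d' → Fin p,
      if (∀ j, 0 < (n j : ℕ)) ∧ (∀ i j : Fin d', i < j → (n j : ℕ) < (n i : ℕ)) ∧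
         (∀ j : Fin d', (n j : ℕ) % 2 = a' j % 2)
      then ∏ j, (((n j : ℕ) : ZMod p) ^ s' j)⁻¹ else 0) =
    (-1 : ZMod p) ^ (∑ i, s i) * ∑ n : Fin d → Fin p,
      if (∀ j, 0 < (n j : ℕ)) ∧ (∀ i j : Fin d, i < j → (n j : ℕ) < (n i : ℕ)) ∧
         (∀ j : Fin d, (n j : ℕ) % 2 = a j % 2)
      then ∏ j, (((n j : ℕ) : ZMod p) ^ s j)⁻¹ else 0 := by
  have : Fact p.Prime := ⟨hp⟩
  have : NeZero p := ⟨hp.ne_zero⟩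
  have hpodd : p % 2 = 1 := hp.eq_two_or_odd.resolve_left hp2
  rw [Finset.mul_sum]
  refine Fintype.sum_equiv (e.arrowCongr (Equiv.neg (Fin p))) _ _ fun n => ?_
  have hval : ∀ i, (e.arrowCongr (Equiv.neg (Fin p)) n (e i) : ℕ) = (p - n i) % p := by
    intro i
    simp [Fin.val_neg']
  generalize e.arrowCongr (Equiv.neg (Fin p)) n = m at hval
  have hzero : (∀ j, 0 < (n j : ℕ)) ↔ ∀ j, 0 < (m j : ℕ) := by
    rw [← e.forall_congr_right]
    refine forall_congr' fun i => ?_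
    rw [hval]
    rcases Nat.eq_zero_or_pos (n i : ℕ) with h | h
    · simp [h]
    · rw [Nat.mod_eq_of_lt (by omega)]
      have := (n i).isLt
      omega
  by_cases hn : ∀ j, 0 < (n j : ℕ)
  · have hval' : ∀ i, (m (e i) : ℕ) = p - n i := fun i => by
      rw [hval, Nat.mod_eq_of_lt]
      have := hn i
      have := (n i).isLt
      omega
    have hord : (∀ i j : Fin d', i < j → (n j : ℕ) < (n i : ℕ)) ↔
        ∀ i j : Fin d, i < j → (m j : ℕ) < (m i : ℕ) := by
      rw [forall_comm, ← e.forall_congr_right]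
      refine forall_congr' fun i => ?_
      rw [← e.forall_congr_right]
      refine forall_congr' fun j => ?_
      rw [he, hval', hval']
      have := (n i).isLt
      have := (n j).isLt
      refine imp_congr_right fun _ => ?_
      omega
    have hpar : (∀ j : Fin d', (n j : ℕ) % 2 = a' j % 2) ↔
        ∀ j : Fin d, (m j : ℕ) % 2 = a j % 2 := by
      rw [← e.forall_congr_right]
      refine forall_congr' fun i => ?_
      rw [hval', ha]
      have := (n i).isLt
      omega
    have hprod : ∏ j, (((n j : ℕ) : ZMod p) ^ s' j)⁻¹ =
        (-1 : ZMod p) ^ (∑ i, s i) * ∏ j, (((m j : ℕ) : ZMod p) ^ s j)⁻¹ := by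
      rw [← Finset.prod_pow_eq_pow_sum, ← Finset.prod_mul_distrib]
      refine Fintype.prod_equiv e _ _ fun i => ?_
      rw [hval', hs, Nat.cast_sub (n i).isLt.le, ZMod.natCast_self, zero_sub,
        neg_pow ((n i : ℕ) : ZMod p), mul_inv, ← mul_assoc, ← inv_pow (-1 : ZMod p),
        inv_neg_one, ← mul_pow, neg_one_mul, neg_neg, one_pow, one_mul]
    simp only [hzero, hord, hpar, hprod, mul_ite, mul_zero]
  · rw [if_neg fun h => hn h.1, if_neg fun h => hn (hzero.2 h.1), mul_zero]

/-- Reversal relations in odd depth: for `d` odd, `s ∈ ℕ₊^d`, and every odd prime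
`p`, `T_p(←s) = (−1)^{|s|} S_p(s)` and `S_p(←s) = (−1)^{|s|} T_p(s)`. -/
theorem reversal_odd_depth (s : List ℕ) (hpos : ∀ x ∈ s, 0 < x)
    (hodd : Odd s.length)
    (p : ℕ) (hp : p.Prime) (hp2 : p ≠ 2) :
    TsumP p s.reverse = (-1 : ZMod p) ^ s.sum * SsumP p s ∧
    SsumP p s.reverse = (-1 : ZMod p) ^ s.sum * TsumP p s := by
  have hlen : s.reverse.length = s.length := List.length_reverse
  have hsum : s.sum = ∑ i : Fin s.length, s.get i := by
    simp [Fin.sum_univ_getElem]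
  have key := sum_parity_reflect hp hp2 ((finCongr hlen).trans Fin.revPerm)
    (by intro i j; simp) s.get s.reverse.get (by
      intro i
      simp [List.getElem_reverse, Fin.val_rev, Nat.sub_sub, Nat.add_comm])
  obtain ⟨k, hk⟩ := hodd
  rw [hsum]
  constructor
  · refine key (fun j => s.length - 1 - j) (fun j => s.reverse.length - j) fun i => ?_
    have := i.isLt
    simp [Fin.val_rev]
    omega
  · refine key (fun j => s.length - j) (fun j => s.reverse.length - 1 - j) fun i => ?_
    have := i.isLt
    simp [Fin.val_rev]
    omega
end

section
/- Linear shuffle relation for finite alternating multiple T-values: let s be a positive integer, let u be an admissible word over {y_0, y_1} (containing no letter y_{−1}), and let v be an admissible word over {y_0, y_1, y_{−1}}, such that depth(u) + depth(v) is odd. Then for every odd prime p, T_p((y_0^{s−1} y_1 u) ⧢ v) = (−1)^s · T_p(u ⧢ (y_0^{s−1} y_1 v)) in ℤ/pℤ, where y_0^{s−1} y_1 u denotes concatenation. -/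
open scoped Classical

/-- Finite alternating multiple T-sum `T_p(s;σ)`, with entries `(s_j, σ_j)`:
the sum over `p > n₁ > ⋯ > n_d > 0` with `n_j ≡ d−j+1 (mod 2)` (1-based) of
`∏ σ_j^{(n_j−d+j−1)/2} n_j^{−s_j}` in `ℤ/pℤ` (written 0-based below). -/
noncomputable def TaltP (p : ℕ) (l : List (ℕ × ℤ)) : ZMod p :=
  ∑ n : Fin l.length → Fin p,
    if (∀ j, 0 < (n j : ℕ)) ∧ (∀ i j : Fin l.length, i < j → (n j : ℕ) < (n i : ℕ)) ∧
       (∀ j : Fin l.length, (n j : ℕ) % 2 = (l.length - (j : ℕ)) % 2)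
    then ∏ j, ((l.get j).2 : ZMod p) ^ (((n j : ℕ) + (j : ℕ) - l.length) / 2) *
              (((n j : ℕ) : ZMod p) ^ (l.get j).1)⁻¹
    else 0

/-- The alphabet `{y₀, y₁, y₋₁}`. -/
inductive Letter : Type
  | y0 : Letter
  | y1 : Letter
  | ym1 : Letter
  deriving DecidableEq

/-- The shuffle product of two words, as the multiset of interleavings. -/
def shuffle {α : Type} : List α → List α → Multiset (List α)
  | [], v => {v}
  | a :: u, [] => {a :: u}
  | a :: u, b :: v =>
      (shuffle u (b :: v)).map (List.cons a) + (shuffle (a :: u) v).map (List.cons b)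
termination_by u v => u.length + v.length

/-- A word is admissible if it is empty or does not end in `y₀`. -/
def Admissible (w : List Letter) : Prop := w.getLast? ≠ some Letter.y0

/-- The depth of a word: the number of letters different from `y₀`. -/
def depth (w : List Letter) : ℕ := (w.filter (fun a => a ≠ Letter.y0)).length

/-- Parse an admissible word into its blocks: `y₀^(s-1) y_η ↦ (s, η)`;
returns `none` on non-admissible words. -/
def parseAux : ℕ → List Letter → Option (List (ℕ × ℤ))
  | k, [] => if k = 0 then some [] else none
  | k, Letter.y0 :: w => parseAux (k + 1) w
  | k, Letter.y1 :: w => (parseAux 0 w).map (fun l => (k + 1, (1 : ℤ)) :: l)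
  | k, Letter.ym1 :: w => (parseAux 0 w).map (fun l => (k + 1, (-1 : ℤ)) :: l)

def parse (w : List Letter) : Option (List (ℕ × ℤ)) := parseAux 0 w

/-- Convert the `η`-signs (integral representation) to the `σ`-signs
(series representation): `σ₁ = η₁` and `σ_j = η_j · η_{j-1}` for `j ≥ 2`. -/
def etaToSigma : ℤ → List (ℕ × ℤ) → List (ℕ × ℤ)
  | _, [] => []
  | prev, (s, η) :: l => (s, η * prev) :: etaToSigma η l

/-- `T_p` of an admissible word `y₀^{s₁−1} y_{η₁} ⋯ y₀^{s_d−1} y_{η_d}` is the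
finite alternating multiple T-sum `T_p(s₁,…,s_d; σ₁,…,σ_d)` with `σ₁ = η₁`,
`σ_j = η_j·η_{j−1}`; `T_p` of the empty word is `1`. -/
noncomputable def TwordP (p : ℕ) (w : List Letter) : ZMod p :=
  match parse w with
  | none => 0
  | some blocks => TaltP p (etaToSigma 1 blocks)

/-- `T_p(u ⧢ v) = Σ_{w ∈ u ⧢ v} T_p(w)`, counted with multiplicity. -/
noncomputable def TshufP (p : ℕ) (u v : List Letter) : ZMod p :=
  ((shuffle u v).map (TwordP p)).sum

/-- The power series of `t·ω(t)`, where `ω(t) dt` is the form of the letter: `dt/t` for `y₀` and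
`dt/(1 - η t²)` for `y_η`. -/
noncomputable def letterSeries (R : Type) [CommRing R] : Letter → PowerSeries R
  | Letter.y0 => 1
  | Letter.y1 => PowerSeries.mk fun n => if Odd n then 1 else 0
  | Letter.ym1 => PowerSeries.mk fun n => if Odd n then (-1) ^ (n / 2) else 0

/-- The iterated integral of a word as a power series; the coefficients of index divisible by
`p` are `0`, except the constant coefficient for the empty word. -/
noncomputable def wordSeries (p : ℕ) : List Letter → PowerSeries (ZMod p)
  | [] => 1
  | x :: w => PowerSeries.mk fun n =>
      (n : ZMod p)⁻¹ * PowerSeries.coeff n (wordSeries p w * letterSeries (ZMod p) x)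

/-- The finite alternating multiple T-sum restricted to indices below `M`. -/
noncomputable def truncTaltP (p M : ℕ) (l : List (ℕ × ℤ)) : ZMod p :=
  ∑ n : Fin l.length → Fin p,
    if (∀ j, 0 < (n j : ℕ)) ∧ (∀ i j : Fin l.length, i < j → (n j : ℕ) < (n i : ℕ)) ∧
       (∀ j : Fin l.length, (n j : ℕ) % 2 = (l.length - (j : ℕ)) % 2) ∧
       (∀ j, (n j : ℕ) < M)
    then ∏ j, ((l.get j).2 : ZMod p) ^ (((n j : ℕ) + (j : ℕ) - l.length) / 2) *
              (((n j : ℕ) : ZMod p) ^ (l.get j).1)⁻¹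
    else 0

lemma truncTaltP_self (p : ℕ) (l : List (ℕ × ℤ)) : truncTaltP p p l = TaltP p l := by
  simp [truncTaltP, TaltP]

lemma truncTaltP_nil (p M : ℕ) : truncTaltP p M [] = 1 := by
  simp [truncTaltP]

lemma truncTaltP_cons (p M s : ℕ) (σ : ℤ) (l : List (ℕ × ℤ)) :
    truncTaltP p M ((s, σ) :: l) = ∑ n ∈ Finset.range p,
      if 0 < n ∧ n < M ∧ n % 2 = (l.length + 1) % 2 then
        (σ : ZMod p) ^ ((n - (l.length + 1)) / 2) * ((n : ZMod p) ^ s)⁻¹ * truncTaltP p n l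
      else 0 := by
  rw [← Fin.sum_univ_eq_sum_range (fun n => if 0 < n ∧ n < M ∧ n % 2 = (l.length + 1) % 2 then
        (σ : ZMod p) ^ ((n - (l.length + 1)) / 2) * ((n : ZMod p) ^ s)⁻¹ * truncTaltP p n l
      else 0)]
  unfold truncTaltP
  have e := (Fin.consEquiv (n := l.length) (fun _ => Fin p)).sum_comp
    (fun n : Fin (l.length + 1) → Fin p =>
      if (∀ j, 0 < (n j : ℕ)) ∧ (∀ i j : Fin (l.length + 1), i < j → (n j : ℕ) < (n i : ℕ)) ∧
       (∀ j : Fin (l.length + 1), (n j : ℕ) % 2 = ((l.length + 1) - (j : ℕ)) % 2) ∧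
       (∀ j, (n j : ℕ) < M)
      then ∏ j : Fin (l.length + 1), (((((s, σ) :: l).get j).2 : ℤ) : ZMod p) ^
            (((n j : ℕ) + (j : ℕ) - (l.length + 1)) / 2) *
              (((n j : ℕ) : ZMod p) ^ (((s, σ) :: l).get j).1)⁻¹
      else 0)
  refine Eq.trans e.symm ?_
  rw [Fintype.sum_prod_type]
  refine Finset.sum_congr rfl fun a _ => ?_
  split_ifs with h
  · rw [Finset.mul_sum]
    refine Finset.sum_congr rfl fun n _ => ?_
    have hc : ((∀ j, 0 < ((Fin.consEquiv (fun _ => Fin p) (a, n) j : Fin p) : ℕ)) ∧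
        (∀ i j : Fin (l.length + 1), i < j → ((Fin.consEquiv (fun _ => Fin p) (a, n) j : Fin p) : ℕ)
          < ((Fin.consEquiv (fun _ => Fin p) (a, n) i : Fin p) : ℕ)) ∧
        (∀ j : Fin (l.length + 1), ((Fin.consEquiv (fun _ => Fin p) (a, n) j : Fin p) : ℕ) % 2
          = ((l.length + 1) - (j : ℕ)) % 2) ∧
        (∀ j, ((Fin.consEquiv (fun _ => Fin p) (a, n) j : Fin p) : ℕ) < M)) ↔
        ((∀ j, 0 < (n j : ℕ)) ∧ (∀ i j : Fin l.length, i < j → (n j : ℕ) < (n i : ℕ)) ∧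
       (∀ j : Fin l.length, (n j : ℕ) % 2 = (l.length - (j : ℕ)) % 2) ∧
       (∀ j, (n j : ℕ) < (a : ℕ))) := by
      simp only [Fin.consEquiv_apply, Fin.forall_fin_succ, Fin.cons_zero, Fin.cons_succ,
        Fin.val_zero, Fin.val_succ, Nat.add_sub_add_right, Fin.succ_lt_succ_iff, Fin.succ_pos,
        Fin.not_lt_zero, false_imp_iff, true_imp_iff, true_and, Nat.sub_zero]
      constructor
      · rintro ⟨⟨_, h1⟩, ⟨h2, h3⟩, ⟨_, h4⟩, _⟩
        exact ⟨h1, fun i j hij => (h3 i) j hij, h4, h2⟩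
      · rintro ⟨h1, h2, h3, h4⟩
        exact ⟨⟨h.1, h1⟩, ⟨h4, h2⟩, ⟨h.2.2, h3⟩, h.2.1, fun j => (h4 j).trans h.2.1⟩
    simp only [hc]
    split_ifs
    · rw [Fin.prod_univ_succ]
      simp [Fin.consEquiv_apply, ← add_assoc]
    · simp
  · refine Finset.sum_eq_zero fun n _ => if_neg fun hc => h ?_
    refine ⟨by simpa using hc.1 0, by simpa using hc.2.2.2 0, by simpa using hc.2.2.1 0⟩

lemma coeff_mul_letterSeries_y1 {R : Type} [CommRing R] (f : PowerSeries R) (n : ℕ) :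
    PowerSeries.coeff n (f * letterSeries R Letter.y1) =
      ∑ m ∈ Finset.range n, if Odd (n - m) then PowerSeries.coeff m f else 0 := by
  rw [PowerSeries.coeff_mul, Finset.Nat.sum_antidiagonal_eq_sum_range_succ_mk,
    Finset.sum_range_succ]
  simp [letterSeries]

lemma coeff_mul_letterSeries_ym1 {R : Type} [CommRing R] (f : PowerSeries R) (n : ℕ) :
    PowerSeries.coeff n (f * letterSeries R Letter.ym1) =
      ∑ m ∈ Finset.range n,
        if Odd (n - m) then (-1) ^ ((n - m) / 2) * PowerSeries.coeff m f else 0 := by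
  rw [PowerSeries.coeff_mul, Finset.Nat.sum_antidiagonal_eq_sum_range_succ_mk,
    Finset.sum_range_succ]
  simp [letterSeries, mul_comm]

lemma coeff_wordSeries_cons (p : ℕ) (x : Letter) (w : List Letter) (n : ℕ) :
    PowerSeries.coeff n (wordSeries p (x :: w)) =
      (n : ZMod p)⁻¹ * PowerSeries.coeff n (wordSeries p w * letterSeries (ZMod p) x) := by
  simp [wordSeries]

lemma depth_y0_cons (w : List Letter) : depth (Letter.y0 :: w) = depth w := by simp [depth]

lemma depth_y1_cons (w : List Letter) : depth (Letter.y1 :: w) = depth w + 1 := by simp [depth]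

lemma depth_ym1_cons (w : List Letter) : depth (Letter.ym1 :: w) = depth w + 1 := by simp [depth]

lemma coeff_wordSeries_eq_zero (p : ℕ) (w : List Letter) (n : ℕ)
    (h : ¬(depth w ≤ n ∧ n % 2 = depth w % 2)) : PowerSeries.coeff n (wordSeries p w) = 0 := by
  induction w generalizing n with
  | nil =>
    have : n ≠ 0 := by rintro rfl; simp [depth] at h
    simp [wordSeries, PowerSeries.coeff_one, this]
  | cons x w ih =>
    rw [coeff_wordSeries_cons]
    cases x
    · rw [depth_y0_cons] at h
      simp [letterSeries, ih n h]
    · rw [coeff_mul_letterSeries_y1, Finset.sum_eq_zero, mul_zero]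
      intro m hm
      rw [depth_y1_cons] at h
      rw [Finset.mem_range] at hm
      split_ifs with ho
      · refine ih m ?_
        rw [Nat.odd_iff] at ho
        omega
      · rfl
    · rw [coeff_mul_letterSeries_ym1, Finset.sum_eq_zero, mul_zero]
      intro m hm
      rw [depth_ym1_cons] at h
      rw [Finset.mem_range] at hm
      split_ifs with ho
      · rw [ih m, mul_zero]
        rw [Nat.odd_iff] at ho
        omega
      · rfl

lemma length_etaToSigma (ε : ℤ) (l : List (ℕ × ℤ)) : (etaToSigma ε l).length = l.length := by
  induction l generalizing ε with
  | nil => rfl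
  | cons a l ih => obtain ⟨s, η⟩ := a; simp [etaToSigma, ih]

lemma length_of_parseAux (k : ℕ) (w : List Letter) (l : List (ℕ × ℤ))
    (h : parseAux k w = some l) : l.length = depth w := by
  induction w generalizing k l with
  | nil =>
    simp only [parseAux] at h
    split_ifs at h
    cases h
    rfl
  | cons x w ih =>
    cases x
    · rw [depth_y0_cons]; exact ih _ _ h
    all_goals
      simp only [parseAux, Option.map_eq_some_iff] at h
      obtain ⟨l', hl', rfl⟩ := h
      simp [depth_y1_cons, depth_ym1_cons, ih _ _ hl']

lemma neg_one_pow_congr_of_mod {R : Type} [CommRing R] {a b : ℕ} (h : a % 2 = b % 2) :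
    (-1 : R) ^ a = (-1) ^ b := by
  rw [neg_one_pow_eq_pow_mod_two, h, ← neg_one_pow_eq_pow_mod_two]

lemma truncTaltP_etaToSigma (p M k : ℕ) (hM : 0 < M) (hMp : M ≤ p) (hp : p.Prime) (ε : ℤ)
    (w : List Letter) (l : List (ℕ × ℤ)) (h : parseAux k w = some l) :
    truncTaltP p M (etaToSigma ε l) = ∑ n ∈ Finset.range M,
      (ε : ZMod p) ^ ((n - depth w) / 2) * ((n : ZMod p) ^ k)⁻¹ *
        PowerSeries.coeff n (wordSeries p w) := by
  have := Fact.mk hp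
  have key : ∀ (k M : ℕ) (ε η : ℤ) (w : List Letter) (l : List (ℕ × ℤ)) (x : Letter),
      0 < M → M ≤ p → depth (x :: w) = depth w + 1 → l.length = depth w →
      (∀ n : ℕ, 0 < n → n < M → n % 2 = (depth w + 1) % 2 →
        (η : ZMod p) ^ ((n - (depth w + 1)) / 2) * truncTaltP p n (etaToSigma η l) =
          PowerSeries.coeff n (wordSeries p w * letterSeries (ZMod p) x)) →
      truncTaltP p M (etaToSigma ε ((k + 1, η) :: l)) = ∑ n ∈ Finset.range M,
      (ε : ZMod p) ^ ((n - depth (x :: w)) / 2) * ((n : ZMod p) ^ k)⁻¹ *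
        PowerSeries.coeff n (wordSeries p (x :: w)) := by
    intro k M ε η w l x hM hMp hd hl hn
    rw [etaToSigma, truncTaltP_cons, length_etaToSigma, hl, hd]
    have hsub : Finset.range M ⊆ Finset.range p := by
      intro n; simp only [Finset.mem_range]; omega
    rw [← Finset.sum_subset hsub]
    · refine Finset.sum_congr rfl fun n hnM => ?_
      rw [Finset.mem_range] at hnM
      split_ifs with hc
      · rw [coeff_wordSeries_cons, ← hn n hc.1 hc.2.1 hc.2.2, pow_succ (n : ZMod p), mul_inv]
        push_cast
        rw [mul_pow]
        ring
      · rcases Nat.eq_zero_or_pos n with rfl | h0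
        · rw [coeff_wordSeries_cons]; simp
        · rw [coeff_wordSeries_eq_zero, mul_zero]
          rw [hd]
          tauto
    · intro n _ hnM
      rw [Finset.mem_range] at hnM
      exact if_neg fun hc => hnM hc.2.1
  induction w generalizing k l ε M with
  | nil =>
    simp only [parseAux] at h
    split_ifs at h with hk
    cases h
    subst hk
    rw [etaToSigma, truncTaltP_nil, Finset.sum_eq_single 0]
    · simp [wordSeries]
    · intro n _ hn
      simp [wordSeries, PowerSeries.coeff_one, hn]
    · simp; omega
  | cons x w ih =>
    cases x
    · rw [ih M (k + 1) hM hMp ε l h]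
      refine Finset.sum_congr rfl fun n _ => ?_
      rw [coeff_wordSeries_cons, depth_y0_cons, pow_succ (n : ZMod p), mul_inv]
      simp only [letterSeries, mul_one]
      ring
    · simp only [parseAux, Option.map_eq_some_iff] at h
      obtain ⟨l', hl', rfl⟩ := h
      refine key k M ε 1 w l' _ hM hMp (depth_y1_cons w) (length_of_parseAux _ _ _ hl') ?_
      intro n h0 hnM hpar
      rw [ih n 0 h0 (hnM.le.trans hMp) 1 l' hl', coeff_mul_letterSeries_y1]
      simp only [Int.cast_one, one_pow, one_mul, pow_zero, inv_one]
      refine Finset.sum_congr rfl fun m hm => ?_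
      rw [Finset.mem_range] at hm
      split_ifs with ho
      · rfl
      · refine coeff_wordSeries_eq_zero _ _ _ ?_
        rw [Nat.odd_iff] at ho
        omega
    · simp only [parseAux, Option.map_eq_some_iff] at h
      obtain ⟨l', hl', rfl⟩ := h
      refine key k M ε (-1) w l' _ hM hMp (depth_ym1_cons w) (length_of_parseAux _ _ _ hl') ?_
      intro n h0 hnM hpar
      rw [ih n 0 h0 (hnM.le.trans hMp) (-1) l' hl', coeff_mul_letterSeries_ym1, Finset.mul_sum]
      simp only [Int.cast_one, Int.cast_neg, pow_zero, inv_one, mul_one]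
      refine Finset.sum_congr rfl fun m hm => ?_
      rw [Finset.mem_range] at hm
      by_cases hv : depth w ≤ m ∧ m % 2 = depth w % 2
      · rw [if_pos (by rw [Nat.odd_iff]; omega), ← mul_assoc, ← pow_add]
        congr 1
        refine neg_one_pow_congr_of_mod ?_
        omega
      · simp [coeff_wordSeries_eq_zero p w m hv]

lemma Admissible.of_cons {x : Letter} {w : List Letter} (hw : Admissible (x :: w)) :
    Admissible w := by
  cases w with
  | nil => simp [Admissible]
  | cons y w => simpa [Admissible, List.getLast?_cons_cons] using hw

lemma exists_parseAux (k : ℕ) (w : List Letter) (hw : Admissible w) (hk : k = 0 ∨ w ≠ []) :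
    ∃ l, parseAux k w = some l := by
  induction w generalizing k with
  | nil => exact ⟨[], by simpa [parseAux] using hk⟩
  | cons x w ih =>
    have hw' : Admissible w := hw.of_cons
    cases x
    · refine ih (k + 1) hw' (Or.inr ?_)
      rintro rfl
      simp [Admissible] at hw
    all_goals
      obtain ⟨l, hl⟩ := ih 0 hw' (Or.inl rfl)
      simp [parseAux, hl]

lemma TwordP_eq_coeff (p : ℕ) (hp : p.Prime) (hp2 : p ≠ 2) (w : List Letter) (hw : Admissible w)
    (hd : Even (depth w)) :
    TwordP p w = PowerSeries.coeff p (wordSeries p w * letterSeries (ZMod p) Letter.y1) := by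
  obtain ⟨l, hl⟩ := exists_parseAux 0 w hw (Or.inl rfl)
  have hodd := hp.odd_of_ne_two hp2
  rw [TwordP, parse, hl, coeff_mul_letterSeries_y1]
  simp only
  rw [← truncTaltP_self, truncTaltP_etaToSigma p p 0 hp.pos le_rfl hp 1 w l hl]
  refine Finset.sum_congr rfl fun m hm => ?_
  rw [Finset.mem_range] at hm
  rw [Nat.odd_iff] at hodd
  rw [Nat.even_iff] at hd
  split_ifs with ho
  · simp
  · rw [coeff_wordSeries_eq_zero, mul_zero]
    rw [Nat.odd_iff] at ho
    omega

lemma mem_shuffle {u v w : List Letter} (h : w ∈ shuffle u v) :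
    depth w = depth u + depth v ∧ (Admissible u → Admissible v → Admissible w) ∧
      w.length = u.length + v.length := by
  fun_induction shuffle u v generalizing w with
  | case1 v => rw [Multiset.mem_singleton] at h; subst h; simp [depth]
  | case2 a u =>
    rw [Multiset.mem_singleton] at h
    subst h
    exact ⟨by simp [depth], fun h _ => h, by simp⟩
  | case3 a u b v ih1 ih2 =>
    have hadm : ∀ (x : Letter) (w : List Letter), w ≠ [] → Admissible w → Admissible (x :: w) := by
      intro x w hne hw
      cases w with
      | nil => exact absurd rfl hne
      | cons y w => simpa [Admissible, List.getLast?_cons_cons] using hw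
    have hdep : ∀ (x : Letter) (w : List Letter), depth (x :: w) = depth [x] + depth w := by
      intro x w
      cases x <;> simp [depth, add_comm]
    rw [Multiset.mem_add, Multiset.mem_map, Multiset.mem_map] at h
    rcases h with ⟨w, hw, rfl⟩ | ⟨w, hw, rfl⟩
    · obtain ⟨h1, h2, h3⟩ := ih1 hw
      refine ⟨?_, fun hu hv => hadm _ _ ?_ (h2 hu.of_cons hv), ?_⟩
      · rw [hdep a w, hdep a u, h1, add_assoc]
      · rintro rfl; simp only [List.length_cons, List.length_nil] at h3; omega
      · simp only [List.length_cons] at *; omega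
    · obtain ⟨h1, h2, h3⟩ := ih2 hw
      refine ⟨?_, fun hu hv => hadm _ _ ?_ (h2 hu hv.of_cons), ?_⟩
      · rw [hdep b w, hdep b v, h1]; omega
      · rintro rfl; simp only [List.length_cons, List.length_nil] at h3; omega
      · simp only [List.length_cons] at *; omega

lemma coeff_zero_letterSeries {R : Type} [CommRing R] {x : Letter} (hx : x ≠ Letter.y0) :
    PowerSeries.coeff 0 (letterSeries R x) = 0 := by
  cases x <;> simp_all [letterSeries]

lemma natCast_mul_coeff_wordSeries (p : ℕ) (hp : p.Prime) (x : Letter) (w : List Letter)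
    (hw : Admissible (x :: w)) (n : ℕ) (hn : n < p) :
    (n : ZMod p) * PowerSeries.coeff n (wordSeries p (x :: w)) =
      PowerSeries.coeff n (wordSeries p w * letterSeries (ZMod p) x) := by
  have := Fact.mk hp
  rcases Nat.eq_zero_or_pos n with rfl | h0
  · rw [PowerSeries.coeff_mul, Finset.Nat.antidiagonal_zero, Finset.sum_singleton, Nat.cast_zero,
      zero_mul]
    by_cases hx : x = Letter.y0
    · subst hx
      cases w with
      | nil => simp [Admissible] at hw
      | cons y w => simp [coeff_wordSeries_cons]
    · rw [coeff_zero_letterSeries hx, mul_zero]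
  · rw [coeff_wordSeries_cons, mul_inv_cancel_left₀]
    rw [Ne, ZMod.natCast_eq_zero_iff]
    exact fun h => absurd (Nat.le_of_dvd h0 h) (by omega)

lemma coeff_mul_congr_of_lt {R : Type} [CommRing R] {N : ℕ} {f g : PowerSeries R}
    (h : ∀ n < N, PowerSeries.coeff n f = PowerSeries.coeff n g) (φ : PowerSeries R) :
    ∀ n < N, PowerSeries.coeff n (f * φ) = PowerSeries.coeff n (g * φ) := by
  intro n hn
  rw [PowerSeries.coeff_mul, PowerSeries.coeff_mul]
  refine Finset.sum_congr rfl fun ij hij => ?_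
  have hij := Finset.HasAntidiagonal.mem_antidiagonal.mp hij
  rw [h ij.1 (by omega)]

/-- The sum of the series of the words in a shuffle product. -/
noncomputable def shuffleSeries (p : ℕ) (u v : List Letter) : PowerSeries (ZMod p) :=
  ((shuffle u v).map (wordSeries p)).sum

lemma coeff_shuffleSeries (p : ℕ) (hp : p.Prime) (u v : List Letter) (hu : Admissible u)
    (hv : Admissible v) (n : ℕ) (hn : n < p) :
    PowerSeries.coeff n (shuffleSeries p u v) =
      PowerSeries.coeff n (wordSeries p u * wordSeries p v) := by
  have := Fact.mk hp
  unfold shuffleSeries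
  fun_induction shuffle u v generalizing n with
  | case1 v => simp [wordSeries]
  | case2 a u => simp [wordSeries]
  | case3 a u b v ih1 ih2 =>
    have hcons : ∀ (x : Letter) (S : Multiset (List Letter)),
        PowerSeries.coeff n ((S.map (List.cons x)).map (wordSeries p)).sum =
          (n : ZMod p)⁻¹ * PowerSeries.coeff n
            ((S.map (wordSeries p)).sum * letterSeries (ZMod p) x) := by
      intro x S
      induction S using Multiset.induction_on with
      | empty => simp
      | cons w S ih =>
        simp only [Multiset.map_cons, Multiset.sum_cons, map_add, add_mul, ih,
          coeff_wordSeries_cons, mul_add]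
    rw [Multiset.map_add, Multiset.sum_add, map_add, hcons, hcons,
      coeff_mul_congr_of_lt (ih1 hu.of_cons hv) _ n hn,
      coeff_mul_congr_of_lt (ih2 hu hv.of_cons) _ n hn, ← mul_add, ← map_add]
    have hder : (n : ZMod p) * PowerSeries.coeff n (wordSeries p (a :: u) * wordSeries p (b :: v)) =
        PowerSeries.coeff n
          (wordSeries p u * wordSeries p (b :: v) * letterSeries (ZMod p) a +
            wordSeries p (a :: u) * wordSeries p v * letterSeries (ZMod p) b) := by
      rw [mul_right_comm, mul_assoc (wordSeries p (a :: u)), map_add, PowerSeries.coeff_mul,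
        PowerSeries.coeff_mul, PowerSeries.coeff_mul, Finset.mul_sum, ← Finset.sum_add_distrib]
      refine Finset.sum_congr rfl fun ij hij => ?_
      have hij := Finset.HasAntidiagonal.mem_antidiagonal.mp hij
      rw [← natCast_mul_coeff_wordSeries p hp a u hu ij.1 (by omega),
        ← natCast_mul_coeff_wordSeries p hp b v hv ij.2 (by omega), ← hij]
      push_cast
      ring
    rw [← hder]
    rcases Nat.eq_zero_or_pos n with rfl | h0
    · rw [PowerSeries.coeff_mul, Finset.Nat.antidiagonal_zero, Finset.sum_singleton]
      simp only [coeff_wordSeries_cons, Nat.cast_zero, inv_zero, zero_mul]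
    · rw [inv_mul_cancel_left₀]
      rw [Ne, ZMod.natCast_eq_zero_iff]
      exact fun h => absurd (Nat.le_of_dvd h0 h) (by omega)

lemma TshufP_eq_coeff (p : ℕ) (hp : p.Prime) (hp2 : p ≠ 2) (u v : List Letter)
    (hu : Admissible u) (hv : Admissible v) (hd : Even (depth u + depth v)) :
    TshufP p u v = PowerSeries.coeff p
      (wordSeries p u * wordSeries p v * letterSeries (ZMod p) Letter.y1) := by
  have h1 : TshufP p u v =
      PowerSeries.coeff p (shuffleSeries p u v * letterSeries (ZMod p) Letter.y1) := by
    rw [TshufP, shuffleSeries, ← Multiset.sum_map_mul_right, map_multiset_sum, Multiset.map_map]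
    refine congrArg _ (Multiset.map_congr rfl fun w hw => ?_)
    obtain ⟨h1, h2, -⟩ := mem_shuffle hw
    exact TwordP_eq_coeff p hp hp2 w (h2 hu hv) (h1 ▸ hd)
  rw [h1, coeff_mul_letterSeries_y1, coeff_mul_letterSeries_y1]
  refine Finset.sum_congr rfl fun m hm => ?_
  rw [coeff_shuffleSeries p hp u v hu hv m (Finset.mem_range.mp hm)]

lemma coeff_wordSeries_replicate (p : ℕ) (k : ℕ) (u : List Letter) (n : ℕ) :
    PowerSeries.coeff n
        (wordSeries p (List.replicate k Letter.y0 ++ Letter.y1 :: u)) =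
      ((n : ZMod p)⁻¹) ^ (k + 1) *
        PowerSeries.coeff n (wordSeries p u * letterSeries (ZMod p) Letter.y1) := by
  induction k with
  | zero => simp [coeff_wordSeries_cons]
  | succ k ih =>
    rw [List.replicate_succ, List.cons_append, coeff_wordSeries_cons, letterSeries, mul_one, ih]
    ring

lemma admissible_replicate (k : ℕ) {u : List Letter} (hu : Admissible u) :
    Admissible (List.replicate k Letter.y0 ++ Letter.y1 :: u) := by
  cases u with
  | nil => simp [Admissible]
  | cons x u => simpa [Admissible, List.getLast?_append, List.getLast?_cons] using hu

lemma depth_replicate (k : ℕ) (u : List Letter) :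
    depth (List.replicate k Letter.y0 ++ Letter.y1 :: u) = depth u + 1 := by
  simp [depth, List.filter_append]

/-- Linear shuffle relation for finite alternating multiple T-values:
for `s ≥ 1`, `u` an admissible word over `{y₀, y₁}` and `v` an admissible word
over `{y₀, y₁, y₋₁}` with `depth u + depth v` odd, and every odd prime `p`,
`T_p((y₀^{s−1} y₁ u) ⧢ v) = (−1)^s T_p(u ⧢ (y₀^{s−1} y₁ v))`. -/
theorem linear_shuffle_FAMTV (s : ℕ) (hs : 0 < s) (u v : List Letter)
    (hu1 : Letter.ym1 ∉ u) (hu : Admissible u) (hv : Admissible v)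
    (hdep : Odd (depth u + depth v))
    (p : ℕ) (hp : p.Prime) (hp2 : p ≠ 2) :
    TshufP p (List.replicate (s - 1) Letter.y0 ++ Letter.y1 :: u) v
      = (-1 : ZMod p) ^ s *
        TshufP p u (List.replicate (s - 1) Letter.y0 ++ Letter.y1 :: v) := by
  have := Fact.mk hp
  rw [TshufP_eq_coeff p hp hp2 _ _ (admissible_replicate _ hu) hv
      (by rw [depth_replicate, add_right_comm]; exact hdep.add_one),
    TshufP_eq_coeff p hp hp2 _ _ hu (admissible_replicate _ hv)
      (by rw [depth_replicate, ← add_assoc]; exact hdep.add_one),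
    mul_assoc, mul_right_comm, PowerSeries.coeff_mul, PowerSeries.coeff_mul, Finset.mul_sum]
  refine Finset.sum_congr rfl fun ij hij => ?_
  have hij := Finset.HasAntidiagonal.mem_antidiagonal.mp hij
  rw [coeff_wordSeries_replicate p, coeff_wordSeries_replicate p, Nat.sub_add_cancel hs]
  have hneg : (ij.2 : ZMod p) = -(ij.1 : ZMod p) := by
    rw [eq_neg_iff_add_eq_zero, add_comm, ← Nat.cast_add, hij, ZMod.natCast_self]
  rw [hneg, inv_neg, neg_pow (ij.1 : ZMod p)⁻¹]
  have hone : ((-1 : ZMod p) ^ s) * (-1) ^ s = 1 := by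
    rw [← mul_pow]; simp
  linear_combination (-(((ij.1 : ZMod p)⁻¹) ^ s *
    PowerSeries.coeff ij.1 (wordSeries p u * letterSeries (ZMod p) Letter.y1) *
    PowerSeries.coeff ij.2 (wordSeries p v * letterSeries (ZMod p) Letter.y1))) * hone
end

section
/- Sum formula for finite multiple T-values: let d be an odd positive integer and s = (s_1,…,s_d) a tuple of positive integers. Then for every odd prime p, T_p(1, s_1,…,s_d) + T_p(s_1,…,s_d, 1) + Σ_{j=1}^{d} Σ_{a=1}^{s_j} T_p(s_1,…,s_{j−1}, a, s_j+1−a, s_{j+1},…,s_d) = 0 in ℤ/pℤ (the inner sum runs over those a for which both new entries a and s_j+1−a are positive). -/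
open scoped Classical

/-- The positive integers below `N` in the residue class of `c` modulo `2`. -/
def parityBelow (N c : ℕ) : Finset ℕ :=
  (Finset.range N).filter fun n => 0 < n ∧ n % 2 = c % 2

theorem mem_parityBelow {N c n : ℕ} :
    n ∈ parityBelow N c ↔ n < N ∧ 0 < n ∧ n % 2 = c % 2 := by
  simp [parityBelow]

/-- Finite multiple T-sum with largest summation index below `N`, defined by recursion. -/
def truncTsum (p : ℕ) : ℕ → List ℕ → ZMod p
  | _, [] => 1
  | N, a :: l => ∑ n ∈ parityBelow N (l.length + 1), ((n : ZMod p) ^ a)⁻¹ * truncTsum p n l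

theorem sum_eq_truncTsum (p : ℕ) (s : List ℕ) (N : ℕ) (hN : N ≤ p) :
    (∑ n : Fin s.length → Fin p,
      if (∀ j, (n j : ℕ) < N) ∧ (∀ j, 0 < (n j : ℕ)) ∧
         (∀ i j : Fin s.length, i < j → (n j : ℕ) < (n i : ℕ)) ∧
         (∀ j : Fin s.length, (n j : ℕ) % 2 = (s.length - (j : ℕ)) % 2)
      then ∏ j, (((n j : ℕ) : ZMod p) ^ s.get j)⁻¹ else 0) = truncTsum p N s := by
  induction s generalizing N with
  | nil => simp [truncTsum]
  | cons a l ih =>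
    have key : ∀ x : Fin p × (Fin l.length → Fin p),
        (if (∀ j, ((Fin.cons x.1 x.2 : Fin (l.length + 1) → Fin p) j : ℕ) < N) ∧
            (∀ j, 0 < ((Fin.cons x.1 x.2 : Fin (l.length + 1) → Fin p) j : ℕ)) ∧
            (∀ i j : Fin (l.length + 1), i < j →
              ((Fin.cons x.1 x.2 : Fin (l.length + 1) → Fin p) j : ℕ) <
                ((Fin.cons x.1 x.2 : Fin (l.length + 1) → Fin p) i : ℕ)) ∧
            (∀ j : Fin (l.length + 1), ((Fin.cons x.1 x.2 : Fin (l.length + 1) → Fin p) j : ℕ) % 2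
              = (l.length + 1 - (j : ℕ)) % 2)
          then ∏ j : Fin (l.length + 1),
            ((((Fin.cons x.1 x.2 : Fin (l.length + 1) → Fin p) j : ℕ) : ZMod p) ^
              (a :: l).get j)⁻¹ else 0) =
        if (x.1 : ℕ) < N ∧ 0 < (x.1 : ℕ) ∧ (x.1 : ℕ) % 2 = (l.length + 1) % 2 then
          (((x.1 : ℕ) : ZMod p) ^ a)⁻¹ *
            (if (∀ j, (x.2 j : ℕ) < (x.1 : ℕ)) ∧ (∀ j, 0 < (x.2 j : ℕ)) ∧
              (∀ i j : Fin l.length, i < j → (x.2 j : ℕ) < (x.2 i : ℕ)) ∧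
              (∀ j : Fin l.length, (x.2 j : ℕ) % 2 = (l.length - (j : ℕ)) % 2)
            then ∏ j, (((x.2 j : ℕ) : ZMod p) ^ l.get j)⁻¹ else 0)
        else 0 := by
      rintro ⟨x, y⟩
      rw [mul_ite, mul_zero, ← ite_and]
      refine if_congr ?_ ?_ rfl
      · simp only [Fin.forall_fin_succ, Fin.cons_zero, Fin.cons_succ, Fin.succ_lt_succ_iff,
          Fin.val_zero, Fin.val_succ, Nat.add_sub_add_right, Nat.sub_zero, Fin.succ_pos,
          Fin.not_lt_zero, false_imp_iff, true_imp_iff, true_and]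
        constructor
        · rintro ⟨⟨h1, h2⟩, ⟨h3, h4⟩, ⟨h5, h6⟩, h7, h8⟩
          exact ⟨⟨h1, h3, h7⟩, h5, h4, h6, h8⟩
        · rintro ⟨⟨h1, h3, h7⟩, h5, h4, h6, h8⟩
          exact ⟨⟨h1, fun i => (h5 i).trans h1⟩, ⟨h3, h4⟩, ⟨h5, h6⟩, h7, h8⟩
      · rw [Fin.prod_univ_succ]
        simp
    refine (Equiv.sum_comp (Fin.consEquiv fun _ : Fin (l.length + 1) => Fin p) _).symm.trans ?_
    refine (Finset.sum_congr rfl fun x _ => key x).trans ?_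
    rw [Fintype.sum_prod_type]
    have step : ∀ x : Fin p,
        (∑ y : Fin l.length → Fin p,
          if (x : ℕ) < N ∧ 0 < (x : ℕ) ∧ (x : ℕ) % 2 = (l.length + 1) % 2 then
          (((x : ℕ) : ZMod p) ^ a)⁻¹ *
            (if (∀ j, (y j : ℕ) < (x : ℕ)) ∧ (∀ j, 0 < (y j : ℕ)) ∧
              (∀ i j : Fin l.length, i < j → (y j : ℕ) < (y i : ℕ)) ∧
              (∀ j : Fin l.length, (y j : ℕ) % 2 = (l.length - (j : ℕ)) % 2)
            then ∏ j, (((y j : ℕ) : ZMod p) ^ l.get j)⁻¹ else 0)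
          else 0) =
        if (x : ℕ) < N ∧ 0 < (x : ℕ) ∧ (x : ℕ) % 2 = (l.length + 1) % 2 then
          (((x : ℕ) : ZMod p) ^ a)⁻¹ * truncTsum p x l else 0 := by
      intro x
      split_ifs with h
      · rw [← Finset.mul_sum, ih x x.2.le]
      · simp
    refine (Finset.sum_congr rfl fun x _ => step x).trans ?_
    rw [Fin.sum_univ_eq_sum_range (fun x : ℕ =>
      if x < N ∧ 0 < x ∧ x % 2 = (l.length + 1) % 2 then
          ((x : ZMod p) ^ a)⁻¹ * truncTsum p x l else 0) p, ← Finset.sum_filter, truncTsum]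
    refine Finset.sum_congr ?_ fun _ _ => rfl
    ext n
    simp only [Finset.mem_filter, Finset.mem_range, mem_parityBelow]
    omega

theorem TsumP_eq_truncTsum (p : ℕ) (s : List ℕ) : TsumP p s = truncTsum p p s := by
  rw [← sum_eq_truncTsum p s p le_rfl, TsumP]
  refine Finset.sum_congr rfl fun n _ => if_congr ?_ rfl rfl
  simp

/-- The sum over all ways of splitting one entry `x` of the list into `a, x + 1 - a`. -/
def splitSum (p N : ℕ) (s : List ℕ) : ZMod p :=
  ∑ j ∈ Finset.range s.length, ∑ a ∈ Finset.Icc 1 (s.getD j 0),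
    truncTsum p N (s.take j ++ a :: (s.getD j 0 + 1 - a) :: s.drop (j + 1))

theorem splitSum_cons (p N x : ℕ) (l : List ℕ) :
    splitSum p N (x :: l) =
      (∑ n ∈ parityBelow N l.length, ∑ m ∈ parityBelow n (l.length + 1),
        (∑ a ∈ Finset.Icc 1 x, ((n : ZMod p) ^ a)⁻¹ * ((m : ZMod p) ^ (x + 1 - a))⁻¹) *
          truncTsum p m l) +
      ∑ n ∈ parityBelow N l.length, ((n : ZMod p) ^ x)⁻¹ * splitSum p n l := by
  have parity : parityBelow N (l.length + 1 + 1) = parityBelow N l.length := by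
    ext n
    simp only [mem_parityBelow]
    omega
  rw [splitSum, List.length_cons, Finset.sum_range_succ', add_comm]
  congr 1
  · simp only [List.take_zero, List.nil_append, List.getD_cons_zero, List.drop_succ_cons,
      List.drop_zero, truncTsum, List.length_cons, zero_add, parity]
    rw [Finset.sum_comm]
    refine Finset.sum_congr rfl fun n _ => ?_
    simp only [Finset.mul_sum, Finset.sum_mul]
    rw [Finset.sum_comm]
    simp only [mul_assoc]
  · simp only [List.take_succ_cons, List.cons_append, List.getD_cons_succ, List.drop_succ_cons,
      truncTsum, splitSum, Finset.mul_sum]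
    rw [Finset.sum_comm]
    refine Finset.sum_congr rfl fun j hj => ?_
    rw [Finset.sum_comm]
    refine Finset.sum_congr rfl fun a _ => ?_
    rw [Finset.mem_range] at hj
    have hlen : (l.take j ++ a :: (l.getD j 0 + 1 - a) :: l.drop (j + 1)).length =
        l.length + 1 := by
      simp only [List.length_append, List.length_take, List.length_cons, List.length_drop]
      omega
    rw [hlen, parity]

/-- Finite geometric sum, in partial fraction form. -/
theorem sum_inv_pow_mul_inv_pow {K : Type*} [Field K] {u v : K} (hu : u ≠ 0) (hv : v ≠ 0)
    (huv : u - v ≠ 0) (x : ℕ) :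
    ∑ a ∈ Finset.Icc 1 x, (u ^ a)⁻¹ * (v ^ (x + 1 - a))⁻¹ =
      ((v ^ x)⁻¹ - (u ^ x)⁻¹) * (u - v)⁻¹ := by
  induction x with
  | zero => simp
  | succ x ih =>
    rw [Finset.sum_Icc_succ_top (by omega)]
    have : ∀ a ∈ Finset.Icc 1 x, (u ^ a)⁻¹ * (v ^ (x + 1 + 1 - a))⁻¹ =
        ((u ^ a)⁻¹ * (v ^ (x + 1 - a))⁻¹) * v⁻¹ := by
      intro a ha
      rw [Finset.mem_Icc] at ha
      rw [show x + 1 + 1 - a = (x + 1 - a) + 1 by omega, pow_succ, mul_inv, mul_assoc]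
    rw [Finset.sum_congr rfl this, ← Finset.sum_mul, ih,
      show x + 1 + 1 - (x + 1) = 1 by omega]
    field_simp
    ring

theorem natCast_ne_zero_of_lt {p n : ℕ} (h0 : 0 < n) (hn : n < p) : (n : ZMod p) ≠ 0 := by
  rw [Ne, ZMod.natCast_eq_zero_iff]
  exact Nat.not_dvd_of_pos_of_lt h0 hn

theorem natCast_sub_ne_zero_of_lt {p n m : ℕ} (hmn : m < n) (hn : n < p) :
    (n : ZMod p) - m ≠ 0 := by
  rw [← Nat.cast_sub hmn.le]
  exact natCast_ne_zero_of_lt (by omega) (by omega)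

theorem sum_inv_sub_reflect (p N m c : ℕ) (h : N % 2 = m % 2) :
    ∑ n ∈ (parityBelow N c).filter (m < ·), ((N : ZMod p) - n)⁻¹ =
      ∑ n ∈ (parityBelow N c).filter (m < ·), ((n : ZMod p) - m)⁻¹ := by
  refine Finset.sum_nbij' (fun n => N + m - n) (fun n => N + m - n) ?_ ?_ ?_ ?_ ?_ <;>
    intro n hn <;> simp only [Finset.mem_filter, mem_parityBelow] at hn ⊢
  · omega
  · omega
  · omega
  · omega
  · rw [Nat.cast_sub (by omega)]
    push_cast
    congr 1
    ring

theorem sum_parityBelow_comm {M : Type*} [AddCommMonoid M] (N c c' : ℕ) (f : ℕ → ℕ → M) :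
    ∑ n ∈ parityBelow N c, ∑ m ∈ parityBelow n c', f n m =
      ∑ m ∈ parityBelow N c', ∑ n ∈ (parityBelow N c).filter (m < ·), f n m := by
  refine Finset.sum_comm' fun n m => ?_
  simp only [Finset.mem_filter, mem_parityBelow]
  omega

theorem splitSum_add_truncTsum_append_one (p : ℕ) [Fact p.Prime] (l : List ℕ) (N : ℕ)
    (hN : N ≤ p) (hpar : N % 2 = l.length % 2) :
    splitSum p N l + truncTsum p N (l ++ [1]) =
      ∑ m ∈ parityBelow N (l.length + 1), ((N : ZMod p) - m)⁻¹ * truncTsum p m l := by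
  induction l generalizing N with
  | nil =>
    have h := sum_inv_sub_reflect p N 0 1 (by simpa using hpar)
    have hfilter : (parityBelow N 1).filter (0 < ·) = parityBelow N 1 := by
      refine Finset.filter_true_of_mem fun n hn => ?_
      exact (mem_parityBelow.1 hn).2.1
    rw [hfilter] at h
    simpa [splitSum, truncTsum] using h.symm
  | cons x l ih =>
    have hlen : (l ++ [1]).length + 1 = l.length + 2 := by simp
    have parity : parityBelow N (l.length + 2) = parityBelow N l.length := by
      ext n
      simp only [mem_parityBelow]
      omega
    have hsplit : ∀ n ∈ parityBelow N l.length, ∀ m ∈ parityBelow n (l.length + 1),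
        (∑ a ∈ Finset.Icc 1 x, ((n : ZMod p) ^ a)⁻¹ * ((m : ZMod p) ^ (x + 1 - a))⁻¹) *
          truncTsum p m l =
        ((n : ZMod p) - m)⁻¹ * (((m : ZMod p) ^ x)⁻¹ * truncTsum p m l) -
          ((n : ZMod p) ^ x)⁻¹ * (((n : ZMod p) - m)⁻¹ * truncTsum p m l) := by
      intro n hn m hm
      rw [mem_parityBelow] at hn hm
      rw [sum_inv_pow_mul_inv_pow (natCast_ne_zero_of_lt hn.2.1 (by omega))
        (natCast_ne_zero_of_lt hm.2.1 (by omega)) (natCast_sub_ne_zero_of_lt hm.1 (by omega))]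
      ring
    have htail : ∑ n ∈ parityBelow N l.length, ((n : ZMod p) ^ x)⁻¹ * splitSum p n l +
        ∑ n ∈ parityBelow N l.length, ((n : ZMod p) ^ x)⁻¹ * truncTsum p n (l ++ [1]) =
        ∑ n ∈ parityBelow N l.length, ∑ m ∈ parityBelow n (l.length + 1),
          ((n : ZMod p) ^ x)⁻¹ * (((n : ZMod p) - m)⁻¹ * truncTsum p m l) := by
      rw [← Finset.sum_add_distrib]
      refine Finset.sum_congr rfl fun n hn => ?_
      rw [mem_parityBelow] at hn
      rw [← mul_add, ih n (by omega) hn.2.2, Finset.mul_sum]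
    rw [splitSum_cons, List.cons_append, truncTsum, hlen, parity, add_assoc, htail,
      Finset.sum_congr rfl fun n hn => Finset.sum_congr rfl (hsplit n hn)]
    simp only [Finset.sum_sub_distrib, sub_add_cancel]
    rw [List.length_cons, parity]
    simp only [truncTsum, Finset.mul_sum]
    rw [sum_parityBelow_comm, sum_parityBelow_comm]
    refine Finset.sum_congr rfl fun m hm => ?_
    rw [← Finset.sum_mul, ← Finset.sum_mul, sum_inv_sub_reflect]
    rw [mem_parityBelow] at hm
    rw [hpar, hm.2.2, List.length_cons]

/-- Sum formula for finite multiple T-values: for `d` odd, `s ∈ ℕ₊^d`, and every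
odd prime `p`,
`T_p(1,s) + T_p(s,1) + Σ_{j=1}^d Σ_{a=1}^{s_j} T_p(s₁,…,s_{j−1},a,s_j+1−a,s_{j+1},…,s_d) = 0`. -/
theorem sum_formula_FMTV (s : List ℕ) (hpos : ∀ x ∈ s, 0 < x)
    (hodd : Odd s.length)
    (p : ℕ) (hp : p.Prime) (hp2 : p ≠ 2) :
    TsumP p (1 :: s) + TsumP p (s ++ [1]) +
      ∑ j ∈ Finset.range s.length, ∑ a ∈ Finset.Icc 1 (s.getD j 0),
        TsumP p (s.take j ++ a :: (s.getD j 0 + 1 - a) :: s.drop (j + 1)) = 0 := by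
  have : Fact p.Prime := ⟨hp⟩
  have hsum := splitSum_add_truncTsum_append_one p s p le_rfl
    ((hp.eq_two_or_odd.resolve_left hp2).trans (Nat.odd_iff.1 hodd).symm)
  simp only [TsumP_eq_truncTsum]
  rw [add_assoc, add_comm (truncTsum p p (s ++ [1]))]
  rw [splitSum] at hsum
  rw [hsum, truncTsum, ← Finset.sum_add_distrib]
  refine Finset.sum_eq_zero fun m _ => ?_
  rw [ZMod.natCast_self, zero_sub, pow_one, inv_neg]
  ring
end

section
/- For every positive integer d and every odd prime p that does not divide 2d+1 (in particular for every prime p > 2d+1), T_p({1}^{2d}) = 0 in ℤ/pℤ; that is, the finite multiple T-value T_𝒜({1}^{2d}) vanishes. -/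
open scoped Classical

open Polynomial

/-- Finite multiple T-sum with upper bound `N`, defined by recursion on the largest index. -/
def boundedTsum (p : ℕ) : List ℕ → ℕ → ZMod p
  | [], _ => 1
  | a :: s, N => ∑ m ∈ Finset.range N,
      if (m + 1) % 2 = (s.length + 1) % 2
      then (((m + 1 : ℕ) : ZMod p) ^ a)⁻¹ * boundedTsum p s m else 0

/-- A tuple of indices is admissible for the T-sum with upper bound `N`. -/
def TAdmissible {p k : ℕ} (N : ℕ) (n : Fin k → Fin p) : Prop :=
  (∀ j, 0 < (n j : ℕ)) ∧ (∀ i j : Fin k, i < j → (n j : ℕ) < (n i : ℕ)) ∧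
    (∀ j : Fin k, (n j : ℕ) % 2 = (k - (j : ℕ)) % 2) ∧ ∀ j, (n j : ℕ) ≤ N

theorem tAdmissible_cons {p k N : ℕ} (m : Fin p) (n : Fin k → Fin p) :
    TAdmissible N (Fin.cons m n : Fin (k + 1) → Fin p) ↔
      (0 < (m : ℕ) ∧ (m : ℕ) ≤ N ∧ (m : ℕ) % 2 = (k + 1) % 2) ∧
        TAdmissible ((m : ℕ) - 1) n := by
  simp only [TAdmissible, Fin.forall_fin_succ, Fin.cons_zero, Fin.cons_succ, Fin.val_zero,
    Fin.val_succ, Nat.add_sub_add_right, Nat.sub_zero, Fin.succ_lt_succ_iff, Fin.succ_pos,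
    Fin.not_lt_zero, forall_true_left, false_imp_iff, true_and]
  constructor
  · rintro ⟨⟨h1, h2⟩, ⟨h3, h4⟩, ⟨h5, h6⟩, h7, h8⟩
    exact ⟨⟨h1, h7, h5⟩, h2, h4, h6, fun j => Nat.le_sub_one_of_lt (h3 j)⟩
  · rintro ⟨⟨h1, h7, h5⟩, h2, h4, h6, h9⟩
    refine ⟨⟨h1, h2⟩, ⟨fun j => ?_, h4⟩, ⟨h5, h6⟩, h7, fun j => ?_⟩
    · have := h9 j
      omega
    · have := h9 j
      omega

theorem sum_tAdmissible_eq_boundedTsum (p : ℕ) (s : List ℕ) (N : ℕ) (hN : N < p) :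
    (∑ n : Fin s.length → Fin p,
      if TAdmissible N n then ∏ j, (((n j : ℕ) : ZMod p) ^ s.get j)⁻¹ else 0) =
      boundedTsum p s N := by
  induction s generalizing N with
  | nil => simp [TAdmissible, boundedTsum]
  | cons a s ih =>
    have hterm (m : Fin p) :
        (∑ n : Fin s.length → Fin p,
          if TAdmissible N (Fin.cons m n : Fin (s.length + 1) → Fin p) then
            ∏ j, ((((Fin.cons m n : Fin (s.length + 1) → Fin p) j : ℕ) : ZMod p) ^
              (a :: s).get j)⁻¹ else 0) =
        (fun i : ℕ => if 0 < i ∧ i ≤ N ∧ i % 2 = (s.length + 1) % 2 then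
          ((i : ZMod p) ^ a)⁻¹ * boundedTsum p s (i - 1) else 0) m := by
      simp only [tAdmissible_cons]
      split_ifs with h
      · rw [← ih _ (by omega), Finset.mul_sum]
        refine Finset.sum_congr rfl fun n _ => ?_
        simp only [h, true_and, mul_ite, mul_zero, and_self]
        congr 1
        exact Fin.prod_univ_succ _
      · simp [h]
    have hsplit := Fintype.sum_equiv (Fin.consEquiv fun _ : Fin (s.length + 1) => Fin p)
      (fun x => if TAdmissible N (Fin.cons x.1 x.2 : Fin (s.length + 1) → Fin p) then
            ∏ j, ((((Fin.cons x.1 x.2 : Fin (s.length + 1) → Fin p) j : ℕ) : ZMod p) ^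
              (a :: s).get j)⁻¹ else 0)
      (fun n => if TAdmissible N n then ∏ j, (((n j : ℕ) : ZMod p) ^ (a :: s).get j)⁻¹ else 0)
      (fun x => rfl)
    refine hsplit.symm.trans ?_
    rw [Fintype.sum_prod_type, Finset.sum_congr rfl fun m _ => hterm m]
    refine (Fin.sum_univ_eq_sum_range (fun i : ℕ => if 0 < i ∧ i ≤ N ∧ i % 2 = (s.length + 1) % 2 then
      ((i : ZMod p) ^ a)⁻¹ * boundedTsum p s (i - 1) else 0) p).trans ?_
    obtain ⟨q, rfl⟩ : ∃ q, p = q + 1 := ⟨p - 1, by omega⟩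
    rw [Finset.sum_range_succ', boundedTsum]
    simp only [lt_irrefl, false_and, if_false, add_zero]
    symm
    refine (Finset.sum_congr rfl fun m hm => ?_).trans
      (Finset.sum_subset (Finset.range_mono (Nat.le_of_lt_succ hN)) fun m _ hm => ?_)
    · have := Finset.mem_range.1 hm
      simp [show m + 1 ≤ N by omega]
    · rw [Finset.mem_range] at hm
      rw [if_neg (by omega)]

theorem TsumP_eq_boundedTsum (p : ℕ) (hp : 0 < p) (s : List ℕ) :
    TsumP p s = boundedTsum p s (p - 1) := by
  rw [← sum_tAdmissible_eq_boundedTsum p s (p - 1) (by omega), TsumP]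
  refine Finset.sum_congr rfl fun n _ => ?_
  have h : ∀ j, (n j : ℕ) ≤ p - 1 := fun j => by omega
  simp [TAdmissible, h]

/-- The generating polynomial of the T-sums with all exponents one and upper bound `n`, over depths
of the same parity as `n`. -/
noncomputable def tPoly (p : ℕ) : ℕ → (ZMod p)[X]
  | 0 => 1
  | 1 => X
  | n + 2 => tPoly p n + C ((n + 2 : ℕ) : ZMod p)⁻¹ * (X * tPoly p (n + 1))

theorem boundedTsum_replicate_succ (p k N : ℕ) :
    boundedTsum p (List.replicate (k + 1) 1) (N + 1) =
      boundedTsum p (List.replicate (k + 1) 1) N +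
        if (N + 1) % 2 = (k + 1) % 2 then
          ((N + 1 : ℕ) : ZMod p)⁻¹ * boundedTsum p (List.replicate k 1) N else 0 := by
  simp only [List.replicate_succ, boundedTsum, Finset.sum_range_succ, List.length_replicate,
    pow_one]

theorem coeff_tPoly (p n k : ℕ) (h : n % 2 = k % 2) :
    (tPoly p n).coeff k = boundedTsum p (List.replicate k 1) n := by
  induction n using Nat.twoStepInduction generalizing k with
  | zero =>
    cases k <;> simp [tPoly, boundedTsum, List.replicate_succ, coeff_one]
  | one =>
    obtain _ | _ | k := k
    · omega
    · simp [tPoly, boundedTsum]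
    · simp [tPoly, boundedTsum, List.replicate_succ, coeff_X]
  | more n h0 h1 =>
    cases k with
    | zero =>
      rw [tPoly, coeff_add, h0 0 (by omega)]
      simp [boundedTsum]
    | succ k =>
      rw [boundedTsum_replicate_succ, boundedTsum_replicate_succ, if_neg (by omega),
        if_pos (by omega), tPoly, coeff_add, coeff_C_mul, coeff_X_mul, h0 _ (by omega),
        h1 _ (by omega), add_zero]

theorem natDegree_tPoly_le (p n : ℕ) : (tPoly p n).natDegree ≤ n := by
  induction n using Nat.twoStepInduction with
  | zero => simp [tPoly]
  | one => exact natDegree_X_le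
  | more n h0 h1 =>
    rw [tPoly]
    refine natDegree_add_le_of_degree_le (by omega) ((natDegree_C_mul_le _ _).trans ?_)
    refine natDegree_mul_le.trans ?_
    have := natDegree_X_le (R := ZMod p)
    omega

/-- If `(1 - X²) P' = (2X + x) P` and `P(0) = 1`, then the coefficients of `P` in degrees below the
characteristic are the values at `x` of the polynomials `tPoly`. -/
theorem coeff_eq_eval_tPoly {p : ℕ} [Fact p.Prime] (x : ZMod p) (P : (ZMod p)[X])
    (h0 : P.coeff 0 = 1)
    (hP : (1 - X ^ 2) * derivative P = (2 * X + C x) * P) (n : ℕ) (hn : n < p) :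
    P.coeff n = (tPoly p n).eval x := by
  induction n using Nat.twoStepInduction with
  | zero => simp [tPoly, h0]
  | one =>
    have := congrArg (fun Q => coeff Q 0) hP
    simp [mul_coeff_zero, coeff_derivative, h0] at this
    simpa [tPoly] using this
  | more n ih0 ih1 =>
    have hne : ((n + 2 : ℕ) : ZMod p) ≠ 0 := by
      rw [Ne, ZMod.natCast_eq_zero_iff]
      exact Nat.not_dvd_of_pos_of_lt (by omega) hn
    have hX : X * ((1 - X ^ 2) * derivative P) =
        X * derivative P - X ^ 2 * (X * derivative P) := by ring
    have hY : X * ((2 * X + C x) * P) = C 2 * (X ^ 2 * P) + C x * (X * P) := by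
      rw [show (C 2 : (ZMod p)[X]) = 2 from rfl]
      ring
    have key := congrArg (fun Q => coeff (X * Q) (n + 2)) hP
    simp only [hX, hY, coeff_sub, coeff_add, coeff_C_mul, coeff_X_pow_mul] at key
    rw [show n + 2 = (n + 1) + 1 from rfl, coeff_X_mul, coeff_X_mul, coeff_derivative] at key
    have hXD : (X * derivative P).coeff n = n * P.coeff n := by
      cases n with
      | zero => simp
      | succ n => rw [coeff_X_mul, coeff_derivative]; push_cast; ring
    rw [hXD, ih0 (by omega), ih1 (by omega)] at key
    simp only [tPoly, eval_add, eval_mul, eval_C, eval_X]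
    refine mul_left_cancel₀ hne ?_
    rw [mul_add, mul_inv_cancel_left₀ hne]
    push_cast at key ⊢
    linear_combination key

theorem eval_tPoly_two_mul {p : ℕ} [Fact p.Prime] (a : ℕ) (ha : 0 < a) (hap : a < p) :
    (tPoly p (p - 1)).eval (2 * (a : ZMod p)) = 0 := by
  obtain ⟨b, rfl⟩ : ∃ b, a = b + 1 := ⟨a - 1, by omega⟩
  obtain ⟨c, hc⟩ : ∃ c, p = b + c + 2 := ⟨p - b - 2, by omega⟩
  have hcast : (b + c + 2 : (ZMod p)[X]) = 0 := by
    have := congrArg (Nat.cast : ℕ → (ZMod p)[X]) hc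
    rw [CharP.cast_eq_zero] at this
    push_cast at this
    exact this.symm
  have hdeg : ((1 + X : (ZMod p)[X]) ^ b * (1 - X) ^ c).natDegree ≤ b + c := by
    compute_degree
  rw [← coeff_eq_eval_tPoly _ ((1 + X) ^ b * (1 - X) ^ c) _ _ _ (by omega)]
  · exact coeff_eq_zero_of_natDegree_lt (by omega)
  · simp [coeff_zero_eq_eval_zero]
  · have hb : (1 + X : (ZMod p)[X]) * derivative ((1 + X) ^ b) = (b : (ZMod p)[X]) * (1 + X) ^ b := by
      cases b with
      | zero => simp
      | succ b => simp [derivative_pow]; ring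
    have hc' : (1 - X : (ZMod p)[X]) * derivative ((1 - X) ^ c) = -(c : (ZMod p)[X]) * (1 - X) ^ c := by
      cases c with
      | zero => simp
      | succ c => simp [derivative_pow]; ring
    rw [derivative_mul]
    simp only [map_mul, map_natCast, map_ofNat]
    push_cast
    linear_combination (1 - X) * (1 - X) ^ c * hb + (1 + X) * (1 + X) ^ b * hc' -
      (1 + X) * ((1 + X) ^ b * (1 - X) ^ c) * hcast

theorem eval_tPoly_eq_zero {p : ℕ} [Fact p.Prime] (hp2 : p ≠ 2) {x : ZMod p} (hx : x ≠ 0) :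
    (tPoly p (p - 1)).eval x = 0 := by
  have h2 : (2 : ZMod p) ≠ 0 := by
    have := ZMod.ringChar_zmod_n p
    exact Ring.two_ne_zero (by rwa [this])
  have hy : x / 2 ≠ 0 := div_ne_zero hx h2
  have := eval_tPoly_two_mul (p := p) (x / 2).val
    (Nat.pos_of_ne_zero ((ZMod.val_ne_zero _).2 hy)) (ZMod.val_lt _)
  rwa [ZMod.natCast_zmod_val, mul_div_cancel₀ _ h2] at this

theorem tPoly_sub_one {p : ℕ} [Fact p.Prime] (hp2 : p ≠ 2) :
    tPoly p (p - 1) = 1 - X ^ (p - 1) := by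
  have hp := (Fact.out : p.Prime)
  have hodd := hp.eq_two_or_odd.resolve_left hp2
  have hlt := hp.two_le
  refine eq_of_natDegree_lt_card_of_eval_eq' _ _ Finset.univ (fun x _ => ?_) ?_
  · by_cases hx : x = 0
    · have h := coeff_tPoly p (p - 1) 0 (by omega)
      rw [coeff_zero_eq_eval_zero] at h
      simp [hx, h, boundedTsum, show p - 1 ≠ 0 by omega]
    · simp [eval_tPoly_eq_zero hp2 hx, ZMod.pow_card_sub_one_eq_one hx]
  · rw [Finset.card_univ, ZMod.card]
    have h1 := natDegree_tPoly_le p (p - 1)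
    have h2 : (1 - X ^ (p - 1) : (ZMod p)[X]).natDegree ≤ p - 1 := by compute_degree
    exact max_lt (by omega) (by omega)

/-- For every `d ≥ 1` and every odd prime `p` not dividing `2d+1`,
`T_p({1}^{2d}) = 0` in `ℤ/pℤ`. -/
theorem T_ones_even_vanishes (d : ℕ) (hd : 0 < d)
    (p : ℕ) (hp : p.Prime) (hp2 : p ≠ 2) (hdvd : ¬ p ∣ (2 * d + 1)) :
    TsumP p (List.replicate (2 * d) 1) = 0 := by
  have : Fact p.Prime := ⟨hp⟩
  have hodd := hp.eq_two_or_odd.resolve_left hp2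
  have hne : 2 * d ≠ p - 1 := fun h => hdvd ⟨1, by have := hp.two_le; omega⟩
  rw [TsumP_eq_boundedTsum p hp.pos, ← coeff_tPoly p _ _ (by omega), tPoly_sub_one hp2]
  simp [coeff_one, coeff_X_pow, hne, hd.ne']
end

section
/- There exists N such that for every prime p > N the following evaluations hold in ℤ/pℤ, where q = q_p is the Fermat quotient and β = B_{p−3}/3: ζ_p(1,1,1) = 0; ζ_p(1̄,1̄,1̄) = −(4/3)q³ − (1/2)β; ζ_p(1,1,1̄) = ζ_p(1̄,1,1) = −(1/3)q³ − (7/8)β; ζ_p(1̄,1,1̄) = 0; ζ_p(1,1̄,1) = (2/3)q³ + (1/4)β; and ζ_p(1̄,1̄,1) = −ζ_p(1,1̄,1̄) = −q³ − (21/8)β. -/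
open scoped Classical

/-- Finite Euler sum `ζ_p(s;σ)`, with entries `(s_j, σ_j)`: the sum over
`p > n₁ > ⋯ > n_d > 0` of `∏ σ_j^{n_j} n_j^{−s_j}` in `ℤ/pℤ`. -/
noncomputable def ZsumP (p : ℕ) (l : List (ℕ × ℤ)) : ZMod p :=
  ∑ n : Fin l.length → Fin p,
    if (∀ j, 0 < (n j : ℕ)) ∧ (∀ i j : Fin l.length, i < j → (n j : ℕ) < (n i : ℕ))
    then ∏ j, ((l.get j).2 : ZMod p) ^ (n j : ℕ) * (((n j : ℕ) : ZMod p) ^ (l.get j).1)⁻¹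
    else 0

/-- The Fermat quotient `q_p = (2^{p−1} − 1)/p`, reduced mod `p`. -/
def qF (p : ℕ) : ZMod p := (((2 ^ (p - 1) - 1) / p : ℕ) : ZMod p)

/-- Reduction of a rational number mod `p` (numerator over denominator). -/
noncomputable def rQ (p : ℕ) (x : ℚ) : ZMod p := (x.num : ZMod p) * ((x.den : ℕ) : ZMod p)⁻¹

namespace FiniteEulerSum

open Finset

section NestedSums

variable {R : Type*} [CommRing R]

/-- The sum of `f n` over `n < N`. -/
def sum1 (N : ℕ) (f : ℕ → R) : R := ∑ n ∈ range N, f n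

/-- The sum of `f n * g m` over `N > n > m`. -/
def sum2 (N : ℕ) (f g : ℕ → R) : R := ∑ n ∈ range N, f n * sum1 n g

/-- The sum of `f n * g m * h l` over `N > n > m > l`. -/
def sum3 (N : ℕ) (f g h : ℕ → R) : R := ∑ n ∈ range N, f n * sum2 n g h

theorem sum1_succ (N : ℕ) (f : ℕ → R) : sum1 (N + 1) f = sum1 N f + f N :=
  sum_range_succ _ _

theorem sum2_succ (N : ℕ) (f g : ℕ → R) : sum2 (N + 1) f g = sum2 N f g + f N * sum1 N g :=
  sum_range_succ _ _

theorem sum3_succ (N : ℕ) (f g h : ℕ → R) :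
    sum3 (N + 1) f g h = sum3 N f g h + f N * sum2 N g h :=
  sum_range_succ _ _

theorem sum1_mul_sum1 (N : ℕ) (f g : ℕ → R) :
    sum1 N f * sum1 N g = sum2 N f g + sum2 N g f + sum1 N (fun n => f n * g n) := by
  induction N with
  | zero => simp [sum1, sum2]
  | succ N ih =>
    simp only [sum1_succ, sum2_succ]
    linear_combination ih

theorem sum1_mul_sum2 (N : ℕ) (f g h : ℕ → R) :
    sum1 N f * sum2 N g h = sum3 N f g h + sum3 N g f h + sum3 N g h f
      + sum2 N (fun n => f n * g n) h + sum2 N g (fun n => f n * h n) := by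
  induction N with
  | zero => simp [sum1, sum2, sum3]
  | succ N ih =>
    simp only [sum1_succ, sum2_succ, sum3_succ]
    linear_combination ih + g N * sum1_mul_sum1 N f h

/-- The elementary symmetric polynomial of degree three in terms of power sums. -/
theorem six_mul_sum3_self (N : ℕ) (f : ℕ → R) :
    6 * sum3 N f f f = sum1 N f ^ 3 - 3 * sum1 N f * sum1 N (fun n => f n ^ 2)
      + 2 * sum1 N (fun n => f n ^ 3) := by
  have two (N : ℕ) : 2 * sum2 N f f = sum1 N f ^ 2 - sum1 N (fun n => f n ^ 2) := by
    simp only [sq]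
    linear_combination -sum1_mul_sum1 N f f
  induction N with
  | zero => simp [sum1, sum3]
  | succ N ih =>
    simp only [sum1_succ, sum3_succ]
    linear_combination ih + 3 * f N * two N

theorem sum1_reflect {N : ℕ} {f : ℕ → R} (h0 : f 0 = 0) (hN : f N = 0) :
    sum1 N f = sum1 N (fun n => f (N - n)) := by
  have := sum_range_reflect f (N + 1)
  rw [sum_range_succ f, hN, add_zero, sum_range_succ] at this
  simpa [sum1, h0] using this.symm

theorem sum1_congr {N : ℕ} {f f' : ℕ → R} (hf : ∀ n < N, f n = f' n) : sum1 N f = sum1 N f' :=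
  sum_congr rfl fun n hn => hf n (mem_range.mp hn)

theorem sum2_congr {N : ℕ} {f f' g g' : ℕ → R} (hf : ∀ n < N, f n = f' n)
    (hg : ∀ n < N, g n = g' n) : sum2 N f g = sum2 N f' g' :=
  sum1_congr fun n hn => by rw [hf n hn, sum1_congr fun m hm => hg m (hm.trans hn)]

theorem sum3_congr {N : ℕ} {f f' g g' h h' : ℕ → R} (hf : ∀ n < N, f n = f' n)
    (hg : ∀ n < N, g n = g' n) (hh : ∀ n < N, h n = h' n) : sum3 N f g h = sum3 N f' g' h' :=
  sum1_congr fun n hn => by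
    rw [hf n hn, sum2_congr (fun m hm => hg m (hm.trans hn)) fun m hm => hh m (hm.trans hn)]

theorem sum1_mul_left (N : ℕ) (c : R) (f : ℕ → R) :
    sum1 N (fun n => c * f n) = c * sum1 N f := by
  simp [sum1, mul_sum]

theorem sum1_add (N : ℕ) (f g : ℕ → R) :
    sum1 N (fun n => f n + g n) = sum1 N f + sum1 N g :=
  sum_add_distrib

theorem sum2_add_add (N : ℕ) (f f' g g' : ℕ → R) :
    sum2 N (fun n => f n + f' n) (fun n => g n + g' n)
      = sum2 N f g + sum2 N f g' + sum2 N f' g + sum2 N f' g' := by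
  simp only [sum2, sum1_add, ← sum_add_distrib]
  exact sum_congr rfl fun n _ => by ring

theorem sum2_mul_left (N : ℕ) (c d : R) (f g : ℕ → R) :
    sum2 N (fun n => c * f n) (fun n => d * g n) = c * d * sum2 N f g := by
  simp only [sum2, sum1_mul_left, mul_sum]
  exact sum_congr rfl fun n _ => by ring

theorem sum3_mul_left (N : ℕ) (c d e : R) (f g h : ℕ → R) :
    sum3 N (fun n => c * f n) (fun n => d * g n) (fun n => e * h n)
      = c * d * e * sum3 N f g h := by
  simp only [sum3, sum2_mul_left, mul_sum]
  exact sum_congr rfl fun n _ => by ring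

theorem sum2_eq_ite (N : ℕ) (f g : ℕ → R) :
    sum2 N f g = ∑ n ∈ range N, ∑ m ∈ range N, if m < n then f n * g m else 0 := by
  refine sum_congr rfl fun n hn => ?_
  rw [sum1, mul_sum, ← sum_filter]
  congr 1
  ext m
  simp only [mem_range, mem_filter] at hn ⊢
  omega

theorem sum3_eq_ite (N : ℕ) (f g h : ℕ → R) :
    sum3 N f g h = ∑ n ∈ range N, ∑ m ∈ range N, ∑ l ∈ range N,
      if m < n ∧ l < m then f n * g m * h l else 0 := by
  refine sum_congr rfl fun n hn => ?_
  rw [sum2, mul_sum]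
  have : range n = (range N).filter (· < n) := by
    ext m
    simp only [mem_range, mem_filter] at hn ⊢
    omega
  rw [this, sum_filter]
  refine sum_congr rfl fun m hm => ?_
  split_ifs with hmn
  · have : range m = (range N).filter (· < m) := by
      ext l
      simp only [mem_range, mem_filter] at hm ⊢
      omega
    simp only [sum1, hmn, true_and]
    rw [← sum_filter, ← this]
    simp only [mul_sum, mul_assoc]
  · simp [hmn]

theorem sum2_reflect {N : ℕ} {f g : ℕ → R} (fN : f N = 0) (g0 : g 0 = 0)
    (gN : g N = 0) :
    sum2 N f g = sum2 N (fun n => g (N - n)) (fun n => f (N - n)) := by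
  have key := sum1_reflect (N := N) (f := fun n => ∑ m ∈ range N, if m < n then f n * g m else 0)
    (by simp) (by simp [fN])
  rw [sum2_eq_ite, sum2_eq_ite,
    sum_comm (f := fun n m => if m < n then g (N - n) * f (N - m) else 0)]
  refine key.trans (sum_congr rfl fun n hn => ?_)
  refine (sum1_reflect (N := N) (f := fun m => if m < N - n then f (N - n) * g m else 0)
    (by simp [g0]) (by simp [gN])).trans (sum_congr rfl fun m hm => ?_)
  simp only [mem_range] at hn hm
  have : N - m < N - n ↔ n < m := by omega
  simp only [this, mul_comm]

theorem sum3_reflect {N : ℕ} {f g h : ℕ → R} (fN : f N = 0) (gN : g N = 0)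
    (h0 : h 0 = 0) (hN : h N = 0) :
    sum3 N f g h = sum3 N (fun n => h (N - n)) (fun n => g (N - n)) (fun n => f (N - n)) := by
  rw [sum3_eq_ite, sum3_eq_ite]
  have swap (F : ℕ → ℕ → ℕ → R) : ∑ n ∈ range N, ∑ m ∈ range N, ∑ l ∈ range N, F n m l
      = ∑ l ∈ range N, ∑ m ∈ range N, ∑ n ∈ range N, F n m l := by
    rw [sum_comm]
    simp only [sum_comm (s := range N) (f := fun n l => F n _ l)]
    rw [sum_comm]
  rw [swap (fun n m l => if m < n ∧ l < m then h (N - n) * g (N - m) * f (N - l) else 0)]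
  refine (sum1_reflect (N := N) (f := fun n => ∑ m ∈ range N, ∑ l ∈ range N,
    if m < n ∧ l < m then f n * g m * h l else 0) (by simp) (by simp [fN])).trans
    (sum_congr rfl fun n hn => ?_)
  refine (sum1_reflect (N := N) (f := fun m => ∑ l ∈ range N,
    if m < N - n ∧ l < m then f (N - n) * g m * h l else 0) (by simp) (by simp [gN])).trans
    (sum_congr rfl fun m hm => ?_)
  refine (sum1_reflect (N := N) (f := fun l =>
    if N - m < N - n ∧ l < N - m then f (N - n) * g (N - m) * h l else 0)
    (by simp [h0]) (by simp [hN])).trans (sum_congr rfl fun l hl => ?_)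
  simp only [mem_range] at hn hm hl
  have h1 : N - m < N - n ∧ N - l < N - m ↔ m < l ∧ n < m := by omega
  simp only [h1]
  congr 1
  ring

/-- The even-indexed part of a sum with an odd number of terms. -/
theorem sum1_even (M : ℕ) (f : ℕ → R) :
    sum1 (2 * M + 1) (fun n => (1 + (-1) ^ n) * f n) = 2 * sum1 (M + 1) (fun k => f (2 * k)) := by
  induction M with
  | zero => simp [sum1]; ring
  | succ M ih =>
    rw [show 2 * (M + 1) + 1 = 2 * M + 1 + 1 + 1 by ring, sum1_succ, sum1_succ, ih,
      sum1_succ (M + 1)]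
    simp [pow_succ, pow_mul, mul_add]
    ring

theorem sum1_even' (M : ℕ) (f : ℕ → R) :
    sum1 (2 * M) (fun n => (1 + (-1) ^ n) * f n) = 2 * sum1 M (fun k => f (2 * k)) := by
  have h := sum1_even M f
  rw [sum1_succ, sum1_succ] at h
  simp only [even_two, Even.mul_right, Even.neg_pow, one_pow] at h
  linear_combination h

/-- The additive convolution of two sequences. -/
def conv (f g : ℕ → R) (s : ℕ) : R := ∑ k ∈ range (s + 1), f k * g (s - k)

theorem conv_comm (f g : ℕ → R) (s : ℕ) : conv f g s = conv g f s := by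
  rw [conv, ← sum_range_reflect]
  refine sum_congr rfl fun k hk => ?_
  have : k ≤ s := by simpa [Nat.lt_succ_iff] using hk
  rw [show s + 1 - 1 - k = s - k by omega, Nat.sub_sub_self this, mul_comm]

theorem conv_congr {f f' g g' : ℕ → R} {s : ℕ} (hf : ∀ n ≤ s, f n = f' n)
    (hg : ∀ n ≤ s, g n = g' n) : conv f g s = conv f' g' s :=
  sum_congr rfl fun k hk => by
    rw [hf k (Nat.lt_succ_iff.mp (mem_range.mp hk)), hg _ (Nat.sub_le _ _)]

theorem cast_mul_conv (f g : ℕ → R) (s : ℕ) :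
    (s : R) * conv f g s = conv (fun n => n * f n) g s + conv f (fun n => n * g n) s := by
  simp only [conv, mul_sum, ← sum_add_distrib]
  refine sum_congr rfl fun k hk => ?_
  rw [Nat.cast_sub (Nat.lt_succ_iff.mp (mem_range.mp hk))]
  ring

theorem conv_sum1 {f : ℕ → R} (g : ℕ → R) (s : ℕ) :
    conv f (fun m => sum1 m g) s = sum1 s (conv f g) := by
  have := sum_range_diag_flip s fun m k => f m * g k
  simp only [conv, sum1, mul_sum] at this ⊢
  rw [this, sum_range_succ]
  simp

theorem sum1_sum_reflect {N : ℕ} {F : ℕ → ℕ → R} (h0 : ∀ m, F 0 m = 0) :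
    ∑ n ∈ range N, ∑ m ∈ range n, F (N - n) m
      = ∑ s ∈ range N, ∑ k ∈ range (s + 1), F k (s - k) := by
  rw [sum_range_diag_flip N F]
  refine ((sum1_reflect (N := N) (f := fun n => ∑ k ∈ range (N - n), F n k) (by simp [h0])
    (by simp)).trans (sum_congr rfl fun n hn => ?_)).symm
  simp only [Nat.sub_sub_self (mem_range.mp hn).le]

end NestedSums

section Terms

variable (p : ℕ)

/-- The sequence `ε ^ n / n ^ s` modulo `p`. -/
def term (ε : ZMod p) (s n : ℕ) : ZMod p := ε ^ n * (n : ZMod p)⁻¹ ^ s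

variable {p}

theorem term_mul_term (ε δ : ZMod p) (s u n : ℕ) :
    term p ε s n * term p δ u n = term p (ε * δ) (s + u) n := by
  simp only [term, mul_pow, pow_add]
  ring

variable [Fact p.Prime]

theorem term_zero (ε : ZMod p) {s : ℕ} (hs : s ≠ 0) : term p ε s 0 = 0 := by
  simp [term, hs]

theorem term_prime (ε : ZMod p) {s : ℕ} (hs : s ≠ 0) : term p ε s p = 0 := by
  simp [term, hs]

theorem term_sub {ε : ZMod p} (hε : ε ^ 2 = 1) (s : ℕ) {n : ℕ} (hn : n ≤ p) :
    term p ε s (p - n) = ε * (-1) ^ s * term p ε s n := by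
  have h : ε ^ (p - n) = ε * ε ^ n := by
    have hodd : ε ^ p = ε := by simp
    have hsq : ε ^ n * ε ^ n = 1 := by rw [← mul_pow, ← sq, hε, one_pow]
    calc ε ^ (p - n) = ε ^ (p - n) * (ε ^ n * ε ^ n) := by rw [hsq, mul_one]
      _ = ε ^ (p - n + n) * ε ^ n := by rw [pow_add]; ring
      _ = ε * ε ^ n := by rw [Nat.sub_add_cancel hn, hodd]
  rw [term, term, h, Nat.cast_sub hn, CharP.cast_eq_zero, zero_sub, inv_neg, neg_pow]
  ring

theorem sum2_term_reflect {ε δ : ZMod p} (hε : ε ^ 2 = 1) (hδ : δ ^ 2 = 1) {s u : ℕ}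
    (hs : s ≠ 0) (hu : u ≠ 0) :
    sum2 p (term p ε s) (term p δ u)
      = ε * δ * (-1) ^ (s + u) * sum2 p (term p δ u) (term p ε s) := by
  rw [sum2_reflect (term_prime ε hs) (term_zero δ hu) (term_prime δ hu),
    sum2_congr (fun n hn => term_sub hδ u hn.le) (fun n hn => term_sub hε s hn.le),
    sum2_mul_left]
  ring

theorem sum3_term_reflect {ε δ η : ZMod p} (hε : ε ^ 2 = 1) (hδ : δ ^ 2 = 1)
    (hη : η ^ 2 = 1) {s u v : ℕ} (hs : s ≠ 0) (hu : u ≠ 0) (hv : v ≠ 0) :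
    sum3 p (term p ε s) (term p δ u) (term p η v) = ε * δ * η * (-1) ^ (s + u + v)
      * sum3 p (term p η v) (term p δ u) (term p ε s) := by
  rw [sum3_reflect (term_prime ε hs) (term_prime δ hu) (term_zero η hv) (term_prime η hv),
    sum3_congr (fun n hn => term_sub hη v hn.le) (fun n hn => term_sub hδ u hn.le)
      (fun n hn => term_sub hε s hn.le), sum3_mul_left]
  ring

theorem cast_ne_zero_of_lt {n : ℕ} (h0 : n ≠ 0) (hn : n < p) : (n : ZMod p) ≠ 0 := by
  rw [Ne, ZMod.natCast_eq_zero_iff]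
  exact fun h => absurd (Nat.le_of_dvd (Nat.pos_of_ne_zero h0) h) (by omega)

theorem cast_mul_term (s : ℕ) {n : ℕ} (hn : n < p) :
    (n : ZMod p) * term p 1 (s + 2) n = term p 1 (s + 1) n := by
  rcases eq_or_ne n 0 with rfl | h0
  · simp [term]
  · have := cast_ne_zero_of_lt h0 hn
    simp only [term]
    rw [pow_succ _ (s + 1)]
    field_simp

theorem conv_cast_mul_term (g : ℕ → ZMod p) {s : ℕ} (hs : s < p) :
    conv (fun n => n * term p 1 1 n) g s = sum1 s g := by
  rw [conv, sum_range_succ', sum1, ← sum_range_reflect]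
  simp only [Nat.cast_zero, zero_mul, add_zero]
  refine sum_congr rfl fun k hk => ?_
  rw [mem_range] at hk
  have := cast_ne_zero_of_lt (p := p) (n := s - 1 - k + 1) (by omega) (by omega)
  rw [term, one_pow, one_mul, pow_one, mul_inv_cancel₀ this, one_mul]
  congr 1
  omega

theorem eq_term_mul {s : ℕ} {a b : ZMod p} (hs : s < p) (h0 : s = 0 → a = 0)
    (h : (s : ZMod p) * a = b) : a = term p 1 1 s * b := by
  rcases eq_or_ne s 0 with rfl | hs0
  · simp [h0 rfl, term]
  · have := cast_ne_zero_of_lt hs0 hs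
    rw [← h, term]
    field_simp
    simp

theorem conv_term_zero (g : ℕ → ZMod p) {s : ℕ} (hs : s = 0) : conv (term p 1 1) g s = 0 := by
  simp [hs, conv, term]

theorem conv_term_one_one {s : ℕ} (hs : s < p) :
    conv (term p 1 1) (term p 1 1) s = term p 1 1 s * (2 * sum1 s (term p 1 1)) := by
  refine eq_term_mul hs (conv_term_zero _) ?_
  rw [cast_mul_conv, conv_comm (term p 1 1), conv_cast_mul_term _ hs, two_mul]

theorem conv_term_one_two {s : ℕ} (hs : s < p) :
    conv (term p 1 1) (term p 1 2) s
      = 2 * (term p 1 2 s * sum1 s (term p 1 1)) + term p 1 1 s * sum1 s (term p 1 2) := by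
  have h := eq_term_mul (b := sum1 s (term p 1 2) + term p 1 1 s * (2 * sum1 s (term p 1 1))) hs
    (conv_term_zero (term p 1 2)) (by
    rw [cast_mul_conv, conv_cast_mul_term _ hs, ← conv_term_one_one hs]
    congr 1
    exact conv_congr (fun _ _ => rfl) fun n hn => cast_mul_term 0 (hn.trans_lt hs))
  rw [h]
  simp only [term]
  ring

theorem conv_term_one_one_one {s : ℕ} (hs : s < p) :
    conv (term p 1 1) (fun m => term p 1 1 m * sum1 m (term p 1 1)) s
      = 3 * (term p 1 1 s * sum2 s (term p 1 1) (term p 1 1)) := by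
  have h := eq_term_mul (b := 3 * sum2 s (term p 1 1) (term p 1 1)) hs
    (conv_term_zero fun m => term p 1 1 m * sum1 m (term p 1 1)) (by
    have h1 : conv (term p 1 1) (fun m => m * (term p 1 1 m * sum1 m (term p 1 1))) s
        = conv (term p 1 1) (fun m => sum1 m (term p 1 1)) s := by
      refine conv_congr (fun _ _ => rfl) fun n hn => ?_
      rcases eq_or_ne n 0 with rfl | h0
      · simp [sum1]
      · have := cast_ne_zero_of_lt h0 (hn.trans_lt hs)
        simp only [term]
        field_simp
        simp
    rw [cast_mul_conv, conv_cast_mul_term _ hs, h1, conv_sum1,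
      sum1_congr fun n hn => conv_term_one_one (hn.trans hs)]
    simp only [mul_left_comm _ (2 : ZMod p), sum1_mul_left]
    change sum2 _ _ _ + 2 * sum2 _ _ _ = _
    ring)
  rw [h]
  ring

theorem sum2_alternating_eq_conv (g : ℕ → ZMod p) :
    sum2 p (term p (-1) 1) (fun m => (-1) ^ m * g m)
      = sum1 p (fun s => (-1) ^ s * conv (term p 1 1) g s) := by
  have h := sum1_sum_reflect (N := p)
    (F := fun n m => term p (-1) 1 n * ((-1) ^ m * g m)) (by simp [term])
  rw [sum2, sum1]
  refine Eq.trans (sum_congr rfl fun n hn => ?_) (h.trans (sum_congr rfl fun s _ => ?_))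
  · rw [sum1, mul_sum]
    refine sum_congr rfl fun m _ => ?_
    rw [term_sub (by norm_num) 1 (mem_range.mp hn).le]
    ring
  · rw [conv, mul_sum]
    refine sum_congr rfl fun k hk => ?_
    have : (-1 : ZMod p) ^ s = (-1) ^ k * (-1) ^ (s - k) := by
      rw [← pow_add]
      congr 1
      have := mem_range.mp hk
      omega
    rw [this, term, term]
    ring

end Terms

section Evaluations

variable {p : ℕ} [Fact p.Prime]

theorem sum_range_cast (f : ZMod p → ZMod p) : ∑ n ∈ range p, f n = ∑ x : ZMod p, f x :=
  sum_bij' (fun n _ => (n : ZMod p)) (fun x _ => x.val) (fun _ _ => mem_univ _)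
    (fun x _ => mem_range.mpr x.val_lt)
    (fun _ hn => ZMod.val_cast_of_lt (mem_range.mp hn))
    (fun x _ => ZMod.natCast_zmod_val x) (fun _ _ => rfl)

theorem sum_range_cast_pow {s : ℕ} (hs : s < p - 1) : ∑ n ∈ range p, (n : ZMod p) ^ s = 0 := by
  rw [sum_range_cast fun x => x ^ s]
  exact FiniteField.sum_pow_lt_card_sub_one _ _ (by rwa [ZMod.card])

theorem sum1_term_eq_zero {s : ℕ} (hs : s < p - 1) : sum1 p (term p 1 s) = 0 := by
  simp only [sum1, term, one_pow, one_mul]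
  rw [sum_range_cast fun x => x⁻¹ ^ s,
    Fintype.sum_equiv (Equiv.inv (ZMod p)) (fun x => x⁻¹ ^ s) (fun x => x ^ s) fun _ => rfl,
    ← sum_range_cast fun x => x ^ s, sum_range_cast_pow hs]

theorem two_ne_zero_of_lt (hp : 5 < p) : (2 : ZMod p) ≠ 0 :=
  mod_cast cast_ne_zero_of_lt (p := p) (n := 2) two_ne_zero (by omega)

theorem eq_zero_of_eq_neg (hp : 5 < p) {x : ZMod p} (h : x = -x) : x = 0 :=
  (mul_eq_zero.mp (show 2 * x = 0 by linear_combination h)).resolve_left (two_ne_zero_of_lt hp)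

/-- Stuffle product in depth one. -/
theorem sum1_term_mul_sum1_term (N : ℕ) (ε δ : ZMod p) (s u : ℕ) :
    sum1 N (term p ε s) * sum1 N (term p δ u) = sum2 N (term p ε s) (term p δ u)
      + sum2 N (term p δ u) (term p ε s) + sum1 N (term p (ε * δ) (s + u)) := by
  rw [sum1_mul_sum1]
  simp only [term_mul_term]

/-- Stuffle product of depth one by depth two. -/
theorem sum1_term_mul_sum2_term (N : ℕ) (ε δ η : ZMod p) (s u v : ℕ) :
    sum1 N (term p ε s) * sum2 N (term p δ u) (term p η v)
      = sum3 N (term p ε s) (term p δ u) (term p η v)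
      + sum3 N (term p δ u) (term p ε s) (term p η v)
      + sum3 N (term p δ u) (term p η v) (term p ε s)
      + sum2 N (term p (ε * δ) (s + u)) (term p η v)
      + sum2 N (term p δ u) (term p (ε * η) (s + v)) := by
  rw [sum1_mul_sum2]
  simp only [term_mul_term]

theorem sum2_altOne_altOne :
    sum2 p (term p (-1) 1) (term p (-1) 1) = 2 * sum2 p (term p (-1) 1) (term p 1 1) := by
  have h := sum2_alternating_eq_conv (term p 1 1)
  rw [sum1_congr fun s hs => by rw [conv_term_one_one hs]] at h
  rw [← sum2_congr (g := fun m => (-1) ^ m * term p 1 1 m) (fun _ _ => rfl)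
    (fun n _ => by simp [term]), h, sum1, sum2, mul_sum]
  exact sum_congr rfl fun n _ => by simp only [term]; ring

theorem sum2_altOne_altTwo :
    sum2 p (term p (-1) 1) (term p (-1) 2)
      = 2 * sum2 p (term p (-1) 2) (term p 1 1) + sum2 p (term p (-1) 1) (term p 1 2) := by
  have h := sum2_alternating_eq_conv (term p 1 2)
  rw [sum1_congr fun s hs => by rw [conv_term_one_two hs]] at h
  rw [← sum2_congr (g := fun m => (-1) ^ m * term p 1 2 m) (fun _ _ => rfl)
    (fun n _ => by simp [term]), h, sum1, sum2, sum2, mul_sum, ← sum_add_distrib]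
  exact sum_congr rfl fun n _ => by simp only [term]; ring

theorem sum3_altOne_altOne_one :
    sum3 p (term p (-1) 1) (term p (-1) 1) (term p 1 1)
      = 3 * sum3 p (term p (-1) 1) (term p 1 1) (term p 1 1) := by
  have h := sum2_alternating_eq_conv (p := p) fun m => term p 1 1 m * sum1 m (term p 1 1)
  rw [sum1_congr fun s hs => by rw [conv_term_one_one_one hs]] at h
  have h2 : sum3 p (term p (-1) 1) (term p (-1) 1) (term p 1 1)
      = sum2 p (term p (-1) 1) fun m => (-1) ^ m * (term p 1 1 m * sum1 m (term p 1 1)) := by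
    refine sum_congr rfl fun n _ => ?_
    congr 1
    exact sum_congr rfl fun m _ => by simp only [term]; ring
  rw [h2, h, sum1, sum3, mul_sum]
  exact sum_congr rfl fun n _ => by simp only [term]; ring

theorem four_mul_sum2_altOne_one (hp : 5 < p) :
    4 * sum2 p (term p (-1) 1) (term p 1 1) = sum1 p (term p (-1) 1) ^ 2 := by
  have h1 := sum1_term_mul_sum1_term p (-1 : ZMod p) (-1) 1 1
  have h2 := sum2_altOne_altOne (p := p)
  norm_num [sum1_term_eq_zero (show 2 < p - 1 by omega)] at h1
  linear_combination -h1 - 2 * h2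

theorem two_mul_sum2_two_altOne (hp : 5 < p) :
    2 * sum2 p (term p 1 2) (term p (-1) 1) = -sum1 p (term p (-1) 3) := by
  have h1 := sum1_term_mul_sum1_term p (1 : ZMod p) (-1) 2 1
  have h2 := sum2_term_reflect (p := p) (ε := 1) (δ := -1) (by norm_num) (by norm_num)
    two_ne_zero one_ne_zero
  norm_num [sum1_term_eq_zero (show 2 < p - 1 by omega)] at h1 h2
  linear_combination -h1 + h2

theorem sum2_altOne_two :
    sum2 p (term p (-1) 1) (term p 1 2) = sum2 p (term p 1 2) (term p (-1) 1) := by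
  have h2 := sum2_term_reflect (p := p) (ε := 1) (δ := -1) (by norm_num) (by norm_num)
    two_ne_zero one_ne_zero
  norm_num at h2
  exact h2.symm

theorem two_mul_sum2_altTwo_one (hp : 5 < p) :
    2 * sum2 p (term p (-1) 2) (term p 1 1) = -sum1 p (term p (-1) 3) := by
  have h1 := sum1_term_mul_sum1_term p (-1 : ZMod p) 1 2 1
  have h2 := sum2_term_reflect (p := p) (ε := -1) (δ := 1) (by norm_num) (by norm_num)
    two_ne_zero one_ne_zero
  norm_num [sum1_term_eq_zero (show 1 < p - 1 by omega)] at h1 h2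
  linear_combination -h1 + h2

theorem two_mul_sum2_altOne_altTwo (hp : 5 < p) :
    2 * sum2 p (term p (-1) 1) (term p (-1) 2) = -3 * sum1 p (term p (-1) 3) := by
  linear_combination 2 * sum2_altOne_altTwo (p := p) + 2 * two_mul_sum2_altTwo_one hp
    + 2 * sum2_altOne_two (p := p) + two_mul_sum2_two_altOne hp

theorem sum2_altTwo_altOne :
    sum2 p (term p (-1) 2) (term p (-1) 1) = -sum2 p (term p (-1) 1) (term p (-1) 2) := by
  have h2 := sum2_term_reflect (p := p) (ε := -1) (δ := -1) (by norm_num) (by norm_num)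
    two_ne_zero one_ne_zero
  norm_num at h2
  exact h2

theorem sum1_term_reflect_succ (hp : 5 < p) {n : ℕ} (hn : n < p) :
    sum1 (n + 1) (term p 1 1) = sum1 (p - n) (term p 1 1) := by
  induction n with
  | zero =>
    rw [sum1_succ, Nat.sub_zero, sum1_term_eq_zero (show 1 < p - 1 by omega)]
    simp [sum1, term]
  | succ n ih =>
    have h := term_sub (p := p) (ε := 1) (one_pow 2) 1 hn.le
    have h' := sum1_succ (p - (n + 1)) (term p 1 1)
    rw [show p - (n + 1) + 1 = p - n by omega] at h'
    rw [sum1_succ]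
    linear_combination ih (by omega) + h' + h

theorem alternating_add_term (s n : ℕ) :
    (1 + (-1) ^ n) * term p 1 s n = term p 1 s n + term p (-1) s n := by
  simp only [term]
  ring

theorem two_pow_mul_term_two_mul (hp : 5 < p) (s n : ℕ) :
    2 ^ s * term p 1 s (2 * n) = term p 1 s n := by
  have := two_ne_zero_of_lt hp
  simp only [term, one_pow, one_mul, Nat.cast_mul, ← mul_pow, Nat.cast_ofNat, mul_inv]
  rw [mul_inv_cancel_left₀ this]

theorem two_pow_mul_sum1_even (hp : 5 < p) {M s : ℕ} (hM : p = 2 * M + 1) :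
    2 ^ s * (sum1 p (term p 1 s) + sum1 p (term p (-1) s)) = 2 * sum1 (M + 1) (term p 1 s) := by
  have h := sum1_even M (term p 1 s)
  rw [← hM] at h
  simp only [alternating_add_term, sum1_add] at h
  rw [h, mul_left_comm, ← sum1_mul_left]
  simp only [two_pow_mul_term_two_mul hp]

theorem eight_mul_sum2_even (hp : 5 < p) {M : ℕ} (hM : p = 2 * M + 1) :
    8 * (sum2 p (term p 1 2) (term p 1 1) + sum2 p (term p 1 2) (term p (-1) 1)
      + sum2 p (term p (-1) 2) (term p 1 1) + sum2 p (term p (-1) 2) (term p (-1) 1))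
      = 4 * sum2 (M + 1) (term p 1 2) (term p 1 1) := by
  have h := sum1_even M fun n => term p 1 2 n * sum1 n fun m => (1 + (-1) ^ m) * term p 1 1 m
  rw [← hM] at h
  simp only [sum1_even', ← mul_assoc] at h
  rw [← sum2_add_add]
  simp only [← alternating_add_term]
  rw [sum2]
  refine (congrArg (8 * ·) h).trans ?_
  simp only [sum1, sum2, mul_sum]
  refine sum_congr rfl fun n _ => sum_congr rfl fun m _ => ?_
  rw [← two_pow_mul_term_two_mul hp 2 n, ← two_pow_mul_term_two_mul hp 1 m]
  ring

theorem sum2_two_one_eq_half (hp : 5 < p) {M : ℕ} (hM : p = 2 * M + 1) :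
    sum2 p (term p 1 2) (term p 1 1)
      = 2 * sum2 (M + 1) (term p 1 2) (term p 1 1) + sum1 (M + 1) (term p 1 3) := by
  have key : ∑ x ∈ range M, term p 1 2 (M + 1 + x) * sum1 (M + 1 + x) (term p 1 1)
      = ∑ x ∈ range M, term p 1 2 (x + 1) * sum1 (x + 1 + 1) (term p 1 1) := by
    rw [← sum_range_reflect]
    refine sum_congr rfl fun x hx => ?_
    rw [mem_range] at hx
    rw [show M + 1 + (M - 1 - x) = p - (x + 1) by omega,
      sum1_term_reflect_succ hp (by omega), term_sub (one_pow 2) 2 (by omega)]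
    ring
  have hsplit : sum2 p (term p 1 2) (term p 1 1) = sum2 (M + 1) (term p 1 2) (term p 1 1)
      + ∑ x ∈ range M, term p 1 2 (M + 1 + x) * sum1 (M + 1 + x) (term p 1 1) := by
    rw [sum2, sum2, ← sum_range_add, show M + 1 + M = p by omega]
  have hshift := sum_range_succ' (fun n => term p 1 2 n * sum1 (n + 1) (term p 1 1)) M
  have hlast : ∑ n ∈ range (M + 1), term p 1 2 n * sum1 (n + 1) (term p 1 1)
      = sum2 (M + 1) (term p 1 2) (term p 1 1) + sum1 (M + 1) (term p 1 3) := by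
    rw [sum2, sum1, ← sum_add_distrib]
    refine sum_congr rfl fun n _ => ?_
    rw [sum1_succ, mul_add, term_mul_term, one_mul]
  rw [term_zero 1 two_ne_zero, zero_mul, add_zero] at hshift
  rw [hsplit, key, ← hshift, hlast]
  ring

theorem sum2_two_one (hp : 5 < p) :
    sum2 p (term p 1 2) (term p 1 1) = -2 * sum1 p (term p (-1) 3) := by
  obtain ⟨M, hM⟩ := (Fact.out : p.Prime).odd_of_ne_two (by omega)
  have h1 := two_pow_mul_sum1_even hp hM (s := 3)
  have h2 := eight_mul_sum2_even hp hM
  have h3 := sum2_two_one_eq_half hp hM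
  rw [sum1_term_eq_zero (show 3 < p - 1 by omega)] at h1
  have h3' : (3 : ZMod p) ≠ 0 := mod_cast cast_ne_zero_of_lt (p := p) (n := 3) three_ne_zero
    (by omega)
  have h6 : (2 * 3 : ZMod p) ≠ 0 := mul_ne_zero (two_ne_zero_of_lt hp) h3'
  apply mul_left_cancel₀ h6
  linear_combination h2 - 2 * h3 + h1 - 4 * two_mul_sum2_two_altOne hp
    - 4 * two_mul_sum2_altTwo_one hp - 8 * sum2_altTwo_altOne (p := p)
    + 4 * two_mul_sum2_altOne_altTwo hp

end Evaluations

section FermatQuotient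

variable {p : ℕ} [Fact p.Prime]

theorem cast_choose_prime_sub_one {k : ℕ} (hk : k < p) :
    (((p - 1).choose k : ℕ) : ZMod p) = (-1) ^ k := by
  induction k with
  | zero => simp
  | succ k ih =>
    have hdvd : p ∣ p.choose (k + 1) := (Fact.out : p.Prime).dvd_choose_self (by omega) hk
    have h := Nat.choose_succ_succ (p - 1) k
    rw [Nat.succ_eq_add_one, Nat.sub_add_cancel (Fact.out : p.Prime).one_le] at h
    have h' := congrArg (Nat.cast : ℕ → ZMod p) h
    rw [(ZMod.natCast_eq_zero_iff _ _).mpr hdvd, Nat.cast_add, ih (by omega)] at h'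
    rw [pow_succ]
    linear_combination -h'

theorem sum1_altOne (hp : 5 < p) : sum1 p (term p (-1) 1) = -2 * qF p := by
  have hprime : p.Prime := Fact.out
  obtain ⟨m, rfl⟩ : ∃ m, p = m + 1 := ⟨p - 1, by omega⟩
  have hdvd : (m + 1) ∣ 2 ^ m - 1 := by
    have := Nat.ModEq.pow_totient
      ((Nat.coprime_primes Nat.prime_two hprime).mpr (by omega))
    rw [Nat.totient_prime hprime, Nat.add_sub_cancel] at this
    exact (Nat.modEq_iff_dvd' Nat.one_le_two_pow).mp this.symm
  choose! c hc using fun k (hk : k < m) =>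
    hprime.dvd_choose_self (k := k + 1) (by omega) (by omega)
  have hsum : 2 * ((2 ^ m - 1) / (m + 1)) = ∑ k ∈ range m, c k := by
    have h1 := Nat.sum_range_choose (m + 1)
    rw [sum_range_succ, sum_range_succ', sum_congr rfl fun k hk => hc k (mem_range.mp hk),
      ← mul_sum, Nat.choose_zero_right, Nat.choose_self, pow_succ] at h1
    have h2 := Nat.mul_div_cancel' hdvd
    have h3 : 1 ≤ 2 ^ m := Nat.one_le_two_pow
    refine Nat.eq_of_mul_eq_mul_left (Nat.succ_pos m) ?_
    rw [Nat.succ_eq_add_one, mul_left_comm, h2]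
    omega
  have hcast : ∀ k < m, (c k : ZMod (m + 1)) = -term (m + 1) (-1) 1 (k + 1) := by
    intro k hk
    have h1 := Nat.add_one_mul_choose_eq m k
    rw [hc k hk, mul_assoc] at h1
    have h2 := congrArg (Nat.cast : ℕ → ZMod (m + 1))
      (Nat.eq_of_mul_eq_mul_left (Nat.succ_pos m) h1)
    have h3 := cast_choose_prime_sub_one (p := m + 1) (k := k) (by omega)
    rw [Nat.add_sub_cancel] at h3
    rw [h3, Nat.cast_mul] at h2
    have h4 := cast_ne_zero_of_lt (p := m + 1) (n := k + 1) (by omega) (by omega)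
    rw [term, pow_one, ← div_eq_mul_inv, pow_succ, ← neg_div, eq_div_iff h4, ← h2]
    ring
  rw [sum1, sum_range_succ', term_zero _ one_ne_zero, add_zero, qF, Nat.add_sub_cancel]
  have := congrArg (Nat.cast : ℕ → ZMod (m + 1)) hsum
  rw [Nat.cast_sum, sum_congr rfl fun k hk => hcast k (mem_range.mp hk), sum_neg_distrib,
    Nat.cast_mul, Nat.cast_ofNat] at this
  linear_combination this

end FermatQuotient

section Bernoulli

variable {p : ℕ} [Fact p.Prime]

theorem den_add_ne_zero {x y : ℚ} (hx : (x.den : ZMod p) ≠ 0) (hy : (y.den : ZMod p) ≠ 0) :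
    ((x + y).den : ZMod p) ≠ 0 := by
  have := map_dvd (Nat.castRingHom (ZMod p)) (Rat.add_den_dvd x y)
  simp only [Nat.coe_castRingHom, Nat.cast_mul] at this
  exact ne_zero_of_dvd_ne_zero (mul_ne_zero hx hy) this

theorem den_mul_ne_zero {x y : ℚ} (hx : (x.den : ZMod p) ≠ 0) (hy : (y.den : ZMod p) ≠ 0) :
    ((x * y).den : ZMod p) ≠ 0 := by
  have := map_dvd (Nat.castRingHom (ZMod p)) (Rat.mul_den_dvd x y)
  simp only [Nat.coe_castRingHom, Nat.cast_mul] at this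
  exact ne_zero_of_dvd_ne_zero (mul_ne_zero hx hy) this

theorem ratCast_sum_of_den_ne_zero {ι : Type*} (s : Finset ι) (f : ι → ℚ)
    (hf : ∀ i ∈ s, ((f i).den : ZMod p) ≠ 0) :
    ((∑ i ∈ s, f i).den : ZMod p) ≠ 0 ∧
      ((∑ i ∈ s, f i : ℚ) : ZMod p) = ∑ i ∈ s, (f i : ZMod p) := by
  classical
  induction s using Finset.induction_on with
  | empty => simp
  | insert a s ha ih =>
    obtain ⟨h1, h2⟩ := ih fun i hi => hf i (mem_insert_of_mem hi)
    have h0 := hf a (mem_insert_self a s)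
    rw [sum_insert ha, sum_insert ha]
    exact ⟨den_add_ne_zero h0 h1, by rw [Rat.cast_add_of_ne_zero h0 h1, h2]⟩

/-- Bernoulli numbers of index less than `p - 1` are `p`-integral. -/
theorem den_bernoulli_ne_zero {i : ℕ} (hi : i < p - 1) :
    ((bernoulli i).den : ZMod p) ≠ 0 := by
  rcases Nat.even_or_odd i with ⟨k, hk⟩ | hodd
  · rw [← two_mul] at hk
    subst hk
    obtain ⟨z, hz⟩ := Bernoulli.vonStaudt_clausen k
    rw [eq_comm, ← eq_sub_iff_add_eq, sub_eq_add_neg, ← sum_neg_distrib] at hz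
    rw [hz]
    refine den_add_ne_zero (by simp) (ratCast_sum_of_den_ne_zero _ _ fun q hq => ?_).1
    simp only [mem_filter, mem_range] at hq
    rw [Rat.neg_den, one_div, Rat.inv_natCast_den_of_pos hq.2.1.pos]
    exact cast_ne_zero_of_lt hq.2.1.ne_zero (by omega)
  · rcases eq_or_ne i 1 with rfl | h1
    · rw [bernoulli_one]
      have : ((-1 / 2 : ℚ)).den = 2 := by norm_num
      rw [this]
      exact cast_ne_zero_of_lt two_ne_zero (by omega)
    · rw [bernoulli_eq_zero_of_odd hodd (by have := hodd.pos; omega)]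
      simp

theorem sum1_term_one_eq_bernoulli (hp : 5 < p) (n : ℕ) :
    sum1 n (term p 1 1) = -∑ i ∈ range (p - 1),
      (bernoulli i : ZMod p) * ((p - 1).choose i * (n : ZMod p) ^ (p - 1 - i)) := by
  have h := sum_range_pow n (p - 2)
  have e1 : p - 2 + 1 = p - 1 := by omega
  have e2 : ((p - 2 : ℕ) : ℚ) + 1 = (p - 1 : ℕ) := by exact_mod_cast e1
  have hne : ((p - 1 : ℕ) : ℚ) ≠ 0 := by
    have : p - 1 ≠ 0 := by omega
    exact_mod_cast this
  rw [e1, e2, ← sum_div, eq_div_iff hne] at h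
  have hden : ∀ i ∈ range (p - 1),
      ((bernoulli i * (((p - 1).choose i * n ^ (p - 1 - i) : ℕ) : ℚ)).den
      : ZMod p) ≠ 0 := fun i hi =>
    den_mul_ne_zero (den_bernoulli_ne_zero (mem_range.mp hi)) (by rw [Rat.den_natCast]; simp)
  have h2 : (((∑ k ∈ range n, k ^ (p - 2)) * (p - 1) : ℕ) : ℚ)
      = ∑ i ∈ range (p - 1), bernoulli i * (((p - 1).choose i * n ^ (p - 1 - i) : ℕ) : ℚ) := by
    rw [Nat.cast_mul, Nat.cast_sum]
    simp only [Nat.cast_pow, Nat.cast_mul, ← mul_assoc]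
    exact h
  have h3 := congrArg (Rat.cast : ℚ → ZMod p) h2
  rw [(ratCast_sum_of_den_ne_zero _ _ hden).2, Rat.cast_natCast] at h3
  have h4 : ∀ i ∈ range (p - 1),
      ((bernoulli i * (((p - 1).choose i * n ^ (p - 1 - i) : ℕ) : ℚ) : ℚ) : ZMod p)
      = (bernoulli i : ZMod p) * ((p - 1).choose i * (n : ZMod p) ^ (p - 1 - i)) := fun i hi => by
    rw [Rat.cast_mul_of_ne_zero (den_bernoulli_ne_zero (mem_range.mp hi))
      (by rw [Rat.den_natCast]; simp), Rat.cast_natCast, Nat.cast_mul, Nat.cast_pow]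
  rw [sum_congr rfl h4, Nat.cast_mul, Nat.cast_sum, Nat.cast_sub (by omega),
    CharP.cast_eq_zero, Nat.cast_one, zero_sub, mul_neg_one] at h3
  rw [← h3, neg_neg, sum1]
  refine sum_congr rfl fun k _ => ?_
  rw [term, one_pow, one_mul, pow_one, Nat.cast_pow]
  rcases eq_or_ne (k : ZMod p) 0 with h0 | h0
  · rw [h0, inv_zero, zero_pow (by omega)]
  · rw [inv_eq_iff_eq_inv, eq_comm, inv_eq_of_mul_eq_one_left]
    rw [← pow_succ', e1, ZMod.pow_card_sub_one_eq_one h0]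

theorem sum2_two_one_eq_bernoulli (hp : 5 < p) :
    sum2 p (term p 1 2) (term p 1 1) = (bernoulli (p - 3) : ZMod p) := by
  have hinner : ∀ i ∈ range (p - 1), i ≠ p - 3 →
      ∑ n ∈ range p, term p 1 2 n * (n : ZMod p) ^ (p - 1 - i) = 0 := by
    intro i hi hne
    rw [mem_range] at hi
    by_cases h2 : i = p - 2
    · rw [show p - 1 - i = 1 by omega, ← sum1_term_eq_zero (show 1 < p - 1 by omega), sum1]
      refine sum_congr rfl fun n hn => ?_
      rw [pow_one, mul_comm, cast_mul_term 0 (mem_range.mp hn)]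
    · rw [← sum_range_cast_pow (show p - 3 - i < p - 1 by omega)]
      refine sum_congr rfl fun n hn => ?_
      rw [show p - 1 - i = p - 3 - i + 2 by omega, pow_add]
      rcases eq_or_ne n 0 with rfl | h0
      · rw [Nat.cast_zero, zero_pow (show p - 3 - i ≠ 0 by omega)]
        simp
      · have := cast_ne_zero_of_lt h0 (mem_range.mp hn)
        rw [term]
        field_simp
        simp
  have hmain : ∑ n ∈ range p, term p 1 2 n * (n : ZMod p) ^ (p - 1 - (p - 3)) = -1 := by
    obtain ⟨m, rfl⟩ : ∃ m, p = m + 1 := ⟨p - 1, by omega⟩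
    have hm : ((m + 1 : ℕ) : ZMod (m + 1)) = 0 := CharP.cast_eq_zero _ _
    rw [sum_range_succ', term_zero 1 two_ne_zero, zero_mul, add_zero,
      show m + 1 - 1 - (m + 1 - 3) = 2 by omega]
    trans ∑ _n ∈ range m, (1 : ZMod (m + 1))
    · refine sum_congr rfl fun n hn => ?_
      have := cast_ne_zero_of_lt (p := m + 1) (n := n + 1) (by omega)
        (by have := mem_range.mp hn; omega)
      rw [term, one_pow, one_mul, ← mul_pow, inv_mul_cancel₀ this, one_pow]
    · rw [sum_const, card_range, nsmul_eq_mul, mul_one]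
      push_cast at hm
      linear_combination hm
  calc sum2 p (term p 1 2) (term p 1 1)
      = -∑ i ∈ range (p - 1), (bernoulli i : ZMod p) * ((p - 1).choose i
          * ∑ n ∈ range p, term p 1 2 n * (n : ZMod p) ^ (p - 1 - i)) := by
        simp only [sum2, sum1_term_one_eq_bernoulli hp, mul_neg, sum_neg_distrib, mul_sum]
        rw [sum_comm]
        exact congrArg _ (sum_congr rfl fun i _ => sum_congr rfl fun n _ => by ring)
    _ = (bernoulli (p - 3) : ZMod p) := by
        rw [sum_eq_single_of_mem (p - 3) (mem_range.mpr (by omega))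
          fun i hi hne => by rw [hinner i hi hne, mul_zero, mul_zero], hmain,
          cast_choose_prime_sub_one (by omega)]
        have : Even (p - 3) := by
          obtain ⟨M, hM⟩ := (Fact.out : p.Prime).odd_of_ne_two (by omega)
          exact ⟨M - 1, by omega⟩
        rw [this.neg_one_pow]
        ring

theorem rQ_eq_ratCast (x : ℚ) : rQ p x = (x : ZMod p) := by
  rw [rQ, Rat.cast_def, div_eq_mul_inv]

theorem rQ_natCast_div (a : ℕ) {b : ℕ} (hb : (b : ZMod p) ≠ 0) :
    rQ p (a / b) = (a : ZMod p) / b := by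
  rw [rQ_eq_ratCast, Rat.cast_div_of_ne_zero (by simp) (by simpa using hb), Rat.cast_natCast,
    Rat.cast_natCast]

theorem three_mul_rQ_bernoulli (hp : 5 < p) :
    3 * rQ p (bernoulli (p - 3) / 3) = (bernoulli (p - 3) : ZMod p) := by
  have h3 : (3 : ZMod p) ≠ 0 :=
    mod_cast cast_ne_zero_of_lt (p := p) (n := 3) three_ne_zero (by omega)
  rw [rQ_eq_ratCast, Rat.cast_div_of_ne_zero (den_bernoulli_ne_zero (by omega))
    (by simpa using h3), Rat.cast_ofNat, mul_div_cancel₀ _ h3]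

end Bernoulli

section Main

variable {p : ℕ} [Fact p.Prime]

theorem ZsumP_eq_sum3 (a b c : ℤ) :
    ZsumP p [(1, a), (1, b), (1, c)] = sum3 p (term p a 1) (term p b 1) (term p c 1) := by
  let e : (Fin 3 → Fin p) ≃ Fin p × Fin p × Fin p :=
    { toFun := fun f => (f 0, f 1, f 2)
      invFun := fun t => ![t.1, t.2.1, t.2.2]
      left_inv := fun f => by ext i; fin_cases i <;> rfl
      right_inv := fun _ => rfl }
  let F : ℕ → ℕ → ℕ → ZMod p := fun x y z =>
    if y < x ∧ z < y then term p a 1 x * term p b 1 y * term p c 1 z else 0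
  have h1 : ZsumP p [(1, a), (1, b), (1, c)]
      = ∑ t : Fin p × Fin p × Fin p, F t.1 t.2.1 t.2.2 := by
    refine Fintype.sum_equiv e _ _ fun f => ?_
    change (if (∀ j : Fin 3, 0 < (f j : ℕ)) ∧ (∀ i j : Fin 3, i < j → (f j : ℕ) < (f i : ℕ))
      then ∏ j : Fin 3, _ else 0) = F (f 0) (f 1) (f 2)
    have hiff : ((∀ j : Fin 3, 0 < (f j : ℕ)) ∧ (∀ i j : Fin 3, i < j → (f j : ℕ) < (f i : ℕ)))
        ↔ 0 < (f 2 : ℕ) ∧ (f 1 : ℕ) < f 0 ∧ (f 2 : ℕ) < f 1 := by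
      constructor
      · rintro ⟨h, h'⟩
        exact ⟨h 2, h' 0 1 (by decide), h' 1 2 (by decide)⟩
      · rintro ⟨h, h', h''⟩
        constructor
        · intro j
          fin_cases j
          exacts [(h.trans h'').trans h', h.trans h'', h]
        · intro i j hij
          fin_cases i <;> fin_cases j <;>
            first | exact h' | exact h'' | exact h''.trans h' | exact absurd hij (by decide)
    simp only [hiff, F]
    rcases Nat.eq_zero_or_pos (f 2 : ℕ) with h0 | h0
    · simp [h0, term]
    · simp only [h0, true_and]
      refine if_congr Iff.rfl ?_ rfl
      rw [Fin.prod_univ_three]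
      simp [term]
  rw [h1, Fintype.sum_prod_type, sum3_eq_ite]
  simp only [Fintype.sum_prod_type]
  rw [← Fin.sum_univ_eq_sum_range (fun x => ∑ y ∈ range p, ∑ z ∈ range p, F x y z)]
  refine sum_congr rfl fun x _ => ?_
  rw [← Fin.sum_univ_eq_sum_range (fun y => ∑ z ∈ range p, F x y z)]
  refine sum_congr rfl fun y _ => ?_
  rw [← Fin.sum_univ_eq_sum_range (fun z => F x y z)]

theorem six_mul_sum3_altOne (hp : 5 < p) :
    6 * sum3 p (term p (-1) 1) (term p (-1) 1) (term p (-1) 1)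
      = sum1 p (term p (-1) 1) ^ 3 + 2 * sum1 p (term p (-1) 3) := by
  have h := six_mul_sum3_self p (term p (-1) 1)
  have hsq : ∀ n, term p (-1) 1 n ^ 2 = term p 1 2 n := fun n => by
    rw [sq, term_mul_term]
    norm_num
  have hcube : ∀ n, term p (-1) 1 n ^ 3 = term p (-1) 3 n := fun n => by
    rw [pow_succ, hsq, term_mul_term]
    norm_num
  simp only [hsq, hcube] at h
  change _ = _ - 3 * _ * sum1 p (term p 1 2) + 2 * sum1 p (term p (-1) 3) at h
  rw [sum1_term_eq_zero (show 2 < p - 1 by omega)] at h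
  linear_combination h

theorem eight_mul_sum3_altOne_altOne_one (hp : 5 < p) :
    8 * sum3 p (term p (-1) 1) (term p (-1) 1) (term p 1 1)
      = sum1 p (term p (-1) 1) ^ 3 + 14 * sum1 p (term p (-1) 3) := by
  have h1 := sum1_term_mul_sum2_term p (-1 : ZMod p) (-1) 1 1 1 1
  have h2 := sum3_term_reflect (p := p) (ε := -1) (δ := 1) (η := -1) (by norm_num) (by norm_num)
    (by norm_num) one_ne_zero one_ne_zero one_ne_zero
  norm_num at h1 h2
  linear_combination -4 * h1 - 4 * eq_zero_of_eq_neg hp h2 - 4 * sum2_two_one hp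
    - 2 * two_mul_sum2_altOne_altTwo hp + sum1 p (term p (-1) 1) * four_mul_sum2_altOne_one hp

theorem sum3_one_altOne_one (hp : 5 < p) :
    sum3 p (term p 1 1) (term p (-1) 1) (term p 1 1)
      = sum1 p (term p (-1) 3) - 2 * sum3 p (term p (-1) 1) (term p 1 1) (term p 1 1) := by
  have h1 := sum1_term_mul_sum2_term p (1 : ZMod p) (-1) 1 1 1 1
  norm_num [sum1_term_eq_zero (show 1 < p - 1 by omega)] at h1
  apply mul_left_cancel₀ (two_ne_zero_of_lt hp)
  linear_combination -2 * h1 - 2 * sum2_altOne_two (p := p) - two_mul_sum2_two_altOne hp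
    - two_mul_sum2_altTwo_one hp

end Main

end FiniteEulerSum

open FiniteEulerSum

/-- Weight-three finite Euler sum evaluations: for all sufficiently large primes
`p`, with `q = q_p` and `β = B_{p−3}/3`:
`ζ_p(1,1,1) = 0`, `ζ_p(1̄,1̄,1̄) = −(4/3)q³ − (1/2)β`,
`ζ_p(1,1,1̄) = ζ_p(1̄,1,1) = −(1/3)q³ − (7/8)β`, `ζ_p(1̄,1,1̄) = 0`,
`ζ_p(1,1̄,1) = (2/3)q³ + (1/4)β`, and
`ζ_p(1̄,1̄,1) = −ζ_p(1,1̄,1̄) = −q³ − (21/8)β`. -/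
theorem weight_three_finite_euler_sums :
    ∃ N : ℕ, ∀ p : ℕ, N < p → p.Prime →
      ZsumP p [(1, 1), (1, 1), (1, 1)] = 0 ∧
      ZsumP p [(1, -1), (1, -1), (1, -1)]
        = -(rQ p (4/3)) * qF p ^ 3 - rQ p (1/2) * rQ p (bernoulli (p - 3) / 3) ∧
      ZsumP p [(1, 1), (1, 1), (1, -1)] = ZsumP p [(1, -1), (1, 1), (1, 1)] ∧
      ZsumP p [(1, -1), (1, 1), (1, 1)]
        = -(rQ p (1/3)) * qF p ^ 3 - rQ p (7/8) * rQ p (bernoulli (p - 3) / 3) ∧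
      ZsumP p [(1, -1), (1, 1), (1, -1)] = 0 ∧
      ZsumP p [(1, 1), (1, -1), (1, 1)]
        = rQ p (2/3) * qF p ^ 3 + rQ p (1/4) * rQ p (bernoulli (p - 3) / 3) ∧
      ZsumP p [(1, -1), (1, -1), (1, 1)] = -ZsumP p [(1, 1), (1, -1), (1, -1)] ∧
      ZsumP p [(1, -1), (1, -1), (1, 1)]
        = -(qF p ^ 3) - rQ p (21/8) * rQ p (bernoulli (p - 3) / 3) := by
  refine ⟨5, fun p hp hprime => ?_⟩
  have : Fact p.Prime := ⟨hprime⟩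
  have h2 : (2 : ZMod p) ≠ 0 := two_ne_zero_of_lt hp
  have h3 : (3 : ZMod p) ≠ 0 := by
    exact_mod_cast cast_ne_zero_of_lt (p := p) (n := 3) three_ne_zero (by omega)
  have h24 : (2 ^ 3 * 3 : ZMod p) ≠ 0 := mul_ne_zero (pow_ne_zero 3 h2) h3
  have key (a b : ℕ) (hb : (b : ZMod p) ≠ 0) : (b : ZMod p) * rQ p (a / b) = a := by
    rw [rQ_natCast_div a hb, mul_div_cancel₀ _ hb]
  have h4 : (4 : ZMod p) ≠ 0 := by convert pow_ne_zero 2 h2; norm_num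
  have h8 : (8 : ZMod p) ≠ 0 := by convert pow_ne_zero 3 h2; norm_num
  have c43 : 3 * rQ p (4 / 3) = 4 := by simpa using key 4 3 (by simpa using h3)
  have c12 : 2 * rQ p (1 / 2) = 1 := by simpa using key 1 2 (by simpa using h2)
  have c13 : 3 * rQ p (1 / 3) = 1 := by simpa using key 1 3 (by simpa using h3)
  have c78 : 8 * rQ p (7 / 8) = 7 := by simpa using key 7 8 (by simpa using h8)
  have c23 : 3 * rQ p (2 / 3) = 2 := by simpa using key 2 3 (by simpa using h3)
  have c14 : 4 * rQ p (1 / 4) = 1 := by simpa using key 1 4 (by simpa using h4)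
  have c218 : 8 * rQ p (21 / 8) = 21 := by simpa using key 21 8 (by simpa using h8)
  have hb : sum1 p (term p (-1) 1) ^ 3 = -8 * qF p ^ 3 := by
    rw [sum1_altOne hp]
    ring
  have ht : -2 * sum1 p (term p (-1) 3) = 3 * rQ p (bernoulli (p - 3) / 3) := by
    rw [three_mul_rQ_bernoulli hp, ← sum2_two_one_eq_bernoulli hp, sum2_two_one hp]
  have hrefl (ε δ η : ZMod p) (hε : ε ^ 2 = 1) (hδ : δ ^ 2 = 1) (hη : η ^ 2 = 1) :=
    sum3_term_reflect hε hδ hη one_ne_zero one_ne_zero one_ne_zero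
  have hsq : (-1 : ZMod p) ^ 2 = 1 := by norm_num
  have hA := six_mul_sum3_altOne hp
  have hB := sum3_altOne_altOne_one (p := p)
  have hC := sum3_one_altOne_one hp
  have hD := eight_mul_sum3_altOne_altOne_one hp
  simp only [ZsumP_eq_sum3, Int.cast_one, Int.cast_neg]
  refine ⟨eq_zero_of_eq_neg hp ?_, mul_left_cancel₀ h24 ?_, ?_, mul_left_cancel₀ h24 ?_,
    eq_zero_of_eq_neg hp ?_, mul_left_cancel₀ h24 ?_, ?_, mul_left_cancel₀ h24 ?_⟩
  · linear_combination hrefl 1 1 1 (one_pow 2) (one_pow 2) (one_pow 2)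
  · linear_combination 4 * (hA + hb - ht + 2 * qF p ^ 3 * c43
      + 3 * rQ p (bernoulli (p - 3) / 3) * c12)
  · linear_combination hrefl 1 1 (-1) (one_pow 2) (one_pow 2) hsq
  · linear_combination -8 * hB + hD + hb - 7 * ht + 8 * qF p ^ 3 * c13
      + 3 * rQ p (bernoulli (p - 3) / 3) * c78
  · linear_combination hrefl (-1) 1 (-1) hsq (one_pow 2) hsq
  · linear_combination 24 * hC - 2 * (-8 * hB + hD + hb - 7 * ht) - 12 * ht
      - 8 * qF p ^ 3 * c23 - 6 * rQ p (bernoulli (p - 3) / 3) * c14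
  · linear_combination hrefl (-1) (-1) 1 hsq hsq (one_pow 2)
  · linear_combination 3 * (hD + hb - 7 * ht + rQ p (bernoulli (p - 3) / 3) * c218)
end

section
/- For every odd prime p, the linear shuffle relation 2·ζ_p(1,1̄,1) + ζ_p(1̄,1̄,1̄) + ζ_p(1̄,1,1̄) = 0 holds in ℤ/pℤ. -/
open scoped Classical

open PowerSeries Finset

section IteratedIntegral

variable {K : Type*} [Field K]

/-- The power series `∑_{n ≥ 1} τ^n X^n`, the expansion of `τX / (1 - τX)`. -/
noncomputable def geomTail (τ : K) : K⟦X⟧ := PowerSeries.mk fun n => if n = 0 then 0 else τ ^ n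

/-- Formal integration of `f` against `τ dx / (1 - τx)`. The coefficients of index divisible by the
characteristic are set to `0`. -/
noncomputable def geomInt (τ : K) (f : K⟦X⟧) : K⟦X⟧ :=
  PowerSeries.mk fun n => (n : K)⁻¹ * coeff n (geomTail τ * f)

lemma coeff_geomInt (τ : K) (f : K⟦X⟧) (n : ℕ) :
    coeff n (geomInt τ f) = (n : K)⁻¹ * coeff n (geomTail τ * f) :=
  coeff_mk _ _

lemma coeff_geomTail_mul {τ : K} (hτ : τ * τ = 1) (f : K⟦X⟧) (n : ℕ) :
    coeff n (geomTail τ * f) = τ ^ n * ∑ m ∈ range n, τ ^ m * coeff m f := by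
  rw [mul_comm, coeff_mul, Nat.sum_antidiagonal_eq_sum_range_succ_mk, sum_range_succ, mul_sum]
  simp only [geomTail, coeff_mk, Nat.sub_self, if_true, mul_zero, add_zero]
  refine sum_congr rfl fun m hm => ?_
  have hm := mem_range.1 hm
  obtain ⟨d, rfl⟩ := Nat.exists_eq_add_of_lt hm
  rw [if_neg (by omega), show m + d + 1 - m = d + 1 by omega,
    show τ ^ (m + d + 1) * (τ ^ m * coeff m f) = τ ^ (d + 1) * (τ * τ) ^ m * coeff m f by ring,
    hτ, one_pow, mul_one, mul_comm]

lemma coeff_geomInt_eq_sum {τ : K} (hτ : τ * τ = 1) (f : K⟦X⟧) (n : ℕ) :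
    coeff n (geomInt τ f) = (n : K)⁻¹ * (τ ^ n * ∑ m ∈ range n, τ ^ m * coeff m f) := by
  rw [coeff_geomInt, coeff_geomTail_mul hτ]

lemma coeff_geomInt_one {τ : K} (hτ : τ * τ = 1) (n : ℕ) :
    coeff n (geomInt τ 1) = (n : K)⁻¹ * τ ^ n := by
  rw [coeff_geomInt_eq_sum hτ]
  rcases n with _ | n
  · simp
  · simp [coeff_one]

lemma coeff_geomTail_mul_congr {τ : K} (hτ : τ * τ = 1) {f g : K⟦X⟧} {n : ℕ}
    (h : ∀ m < n, coeff m f = coeff m g) :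
    coeff n (geomTail τ * f) = coeff n (geomTail τ * g) := by
  rw [coeff_geomTail_mul hτ, coeff_geomTail_mul hτ]
  congr 1
  exact sum_congr rfl fun m hm => by rw [h m (mem_range.1 hm)]

/-- Coefficientwise Leibniz rule for the product of two formal integrals. -/
lemma natCast_mul_coeff_geomInt_mul_geomInt {N : ℕ} (hN : ∀ n, 0 < n → n < N → (n : K) ≠ 0)
    (σ τ : K) (f g : K⟦X⟧) :
    (N : K) * coeff N (geomInt σ f * geomInt τ g) =
      coeff N (geomTail σ * f * geomInt τ g + geomInt σ f * (geomTail τ * g)) := by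
  have tail_zero : ∀ (ρ : K) (h : K⟦X⟧), coeff 0 (geomTail ρ * h) = 0 := fun ρ h => by
    simp [geomTail, coeff_zero_eq_constantCoeff]
  rw [map_add, coeff_mul, coeff_mul, coeff_mul, ← sum_add_distrib, mul_sum]
  refine sum_congr rfl fun ⟨i, j⟩ hij => ?_
  have hij : i + j = N := mem_antidiagonal.1 hij
  simp only [coeff_geomInt]
  rcases Nat.eq_zero_or_pos i with rfl | hi
  · simp [tail_zero]
  rcases Nat.eq_zero_or_pos j with rfl | hj
  · simp [tail_zero]
  have hi' := hN i hi (by omega)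
  have hj' := hN j hj (by omega)
  rw [← hij, Nat.cast_add]
  field_simp

/-- The shuffle product formula below the characteristic. -/
lemma coeff_geomInt_mul_geomInt {N : ℕ} (hN : ∀ n, 0 < n → n ≤ N → (n : K) ≠ 0)
    (σ τ : K) (f g : K⟦X⟧) :
    coeff N (geomInt σ f * geomInt τ g) =
      coeff N (geomInt σ (f * geomInt τ g) + geomInt τ (geomInt σ f * g)) := by
  rcases Nat.eq_zero_or_pos N with rfl | hpos
  · simp only [map_add, coeff_geomInt, coeff_mul 0 (geomInt _ _), Nat.antidiagonal_zero,
      sum_singleton, Nat.cast_zero, inv_zero, zero_mul, add_zero]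
  have key := natCast_mul_coeff_geomInt_mul_geomInt (N := N)
    (fun n h h' => hN n h h'.le) σ τ f g
  have h0 := hN N hpos le_rfl
  apply mul_left_cancel₀ h0
  rw [key, map_add, map_add, coeff_geomInt, coeff_geomInt, mul_add, mul_inv_cancel_left₀ h0,
    mul_inv_cancel_left₀ h0]
  congr 2 <;> ring

/-- The relation coming from the shuffle product of a letter with a word of length three. -/
lemma coeff_geomTail_mul_linear_shuffle {p : ℕ} (hp : (p : K) = 0)
    (hlt : ∀ n, 0 < n → n < p → (n : K) ≠ 0) {σ τ : K} (hσ : σ * σ = 1) (hτ : τ * τ = 1) :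
    2 * coeff p (geomTail σ * geomInt σ (geomInt τ (geomInt τ 1)))
      + coeff p (geomTail σ * geomInt τ (geomInt σ (geomInt τ 1)))
      + coeff p (geomTail σ * geomInt τ (geomInt τ (geomInt σ 1))) = 0 := by
  have key := natCast_mul_coeff_geomInt_mul_geomInt hlt σ σ 1 (geomInt τ (geomInt τ 1))
  rw [hp, zero_mul] at key
  have shuffle_two : ∀ n < p, coeff n (geomInt σ 1 * geomInt τ 1) =
      coeff n (geomInt σ (geomInt τ 1) + geomInt τ (geomInt σ 1)) := fun n hn => by
    simpa using coeff_geomInt_mul_geomInt (fun m h h' => hlt m h (h'.trans_lt hn)) σ τ 1 1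
  have shuffle_three : ∀ n < p, coeff n (geomInt σ 1 * geomInt τ (geomInt τ 1)) =
      coeff n (geomInt σ (geomInt τ (geomInt τ 1)) + geomInt τ (geomInt σ (geomInt τ 1))
        + geomInt τ (geomInt τ (geomInt σ 1))) := fun n hn => by
    rw [coeff_geomInt_mul_geomInt (fun m h h' => hlt m h (h'.trans_lt hn)), one_mul, map_add,
      coeff_geomInt τ (_ * _),
      coeff_geomTail_mul_congr hτ fun m hm => shuffle_two m (hm.trans hn)]
    simp only [mul_add, map_add, coeff_geomInt]
    ring
  rw [mul_one, map_add, mul_left_comm, coeff_geomTail_mul_congr hσ shuffle_three] at key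
  simp only [mul_add, map_add] at key
  linear_combination -key

lemma coeff_geomTail_mul_geomInt_triple {ρ σ τ : K} (hρ : ρ * ρ = 1) (hσ : σ * σ = 1)
    (hτ : τ * τ = 1) (n : ℕ) :
    coeff n (geomTail 1 * geomInt ρ (geomInt σ (geomInt τ 1))) =
      ∑ i ∈ range n, ∑ j ∈ range i, ∑ k ∈ range j,
        (ρ ^ i * (i : K)⁻¹) * ((ρ * σ) ^ j * (j : K)⁻¹) * ((σ * τ) ^ k * (k : K)⁻¹) := by
  simp only [coeff_geomTail_mul (mul_one (1 : K)), coeff_geomInt_eq_sum hρ,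
    coeff_geomInt_eq_sum hσ, coeff_geomInt_one hτ, one_pow, one_mul, mul_sum]
  refine sum_congr rfl fun i _ => sum_congr rfl fun j _ => sum_congr rfl fun k _ => ?_
  ring

end IteratedIntegral

lemma ZsumP_triple (p : ℕ) [Fact p.Prime] (a b c : ℤ) :
    ZsumP p [(1, a), (1, b), (1, c)] =
      ∑ i ∈ range p, ∑ j ∈ range i, ∑ k ∈ range j,
        ((a : ZMod p) ^ i * (i : ZMod p)⁻¹) * ((b : ZMod p) ^ j * (j : ZMod p)⁻¹)
          * ((c : ZMod p) ^ k * (k : ZMod p)⁻¹) := by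
  have range_eq : ∀ i < p, ∀ F : ℕ → ZMod p,
      ∑ j ∈ range i, F j = ∑ j ∈ range p, if j < i then F j else 0 := fun i hi F => by
    rw [← sum_filter]
    congr 1
    ext j
    simp only [mem_range, mem_filter]
    omega
  have expand : ZsumP p [(1, a), (1, b), (1, c)] = ∑ n : Fin 3 → Fin p,
      if (n 1 : ℕ) < n 0 ∧ (n 2 : ℕ) < n 1 then
        ((a : ZMod p) ^ (n 0 : ℕ) * ((n 0 : ℕ) : ZMod p)⁻¹)
          * ((b : ZMod p) ^ (n 1 : ℕ) * ((n 1 : ℕ) : ZMod p)⁻¹)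
          * ((c : ZMod p) ^ (n 2 : ℕ) * ((n 2 : ℕ) : ZMod p)⁻¹)
      else 0 := by
    refine Finset.sum_congr rfl fun (n : Fin 3 → Fin p) _ => ?_
    change (if (∀ j : Fin 3, 0 < (n j : ℕ)) ∧ (∀ i j : Fin 3, i < j → (n j : ℕ) < (n i : ℕ))
      then ∏ j : Fin 3, _ else 0) = _
    rw [Fin.prod_univ_three]
    by_cases h : (n 1 : ℕ) < n 0 ∧ (n 2 : ℕ) < n 1
    · rw [if_pos h]
      by_cases h0 : (n 2 : ℕ) = 0
      · rw [if_neg fun h' => (h'.1 2).ne' h0]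
        simp [h0]
      · rw [if_pos]
        · simp
        · refine ⟨fun j => ?_, fun i j hij => ?_⟩
          · fin_cases j
            exacts [(by omega : 0 < (n 0 : ℕ)), (by omega : 0 < (n 1 : ℕ)),
              (by omega : 0 < (n 2 : ℕ))]
          · fin_cases i <;> fin_cases j <;> simp at hij ⊢ <;> omega
    · rw [if_neg h, if_neg fun h' => h ⟨h'.2 0 1 (by decide), h'.2 1 2 (by decide)⟩]
  rw [expand, ← (Fin.consEquiv fun _ => Fin p).sum_comp, Fintype.sum_prod_type,
    Finset.sum_range]
  refine Finset.sum_congr rfl fun i _ => ?_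
  rw [← (Fin.consEquiv fun _ => Fin p).sum_comp, Fintype.sum_prod_type, range_eq i i.2,
    Finset.sum_range]
  refine Finset.sum_congr rfl fun j _ => ?_
  rw [← (Fin.consEquiv fun _ => Fin p).sum_comp, Fintype.sum_prod_type, range_eq j j.2,
    Finset.sum_range]
  by_cases hij : (j : ℕ) < i
  · rw [if_pos hij]
    refine Finset.sum_congr rfl fun k _ => ?_
    rw [Fintype.sum_unique]
    change (if (j : ℕ) < i ∧ (k : ℕ) < j then _ else _) = _
    simp only [hij, true_and]
    rfl
  · rw [if_neg hij]
    refine Finset.sum_eq_zero fun k _ => Finset.sum_eq_zero fun _ _ => ?_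
    exact if_neg fun h => hij h.1

/-- Linear shuffle relation: for every odd prime `p`,
`2 ζ_p(1,1̄,1) + ζ_p(1̄,1̄,1̄) + ζ_p(1̄,1,1̄) = 0` in `ℤ/pℤ`. -/
theorem linear_shuffle_bcc (p : ℕ) (hp : p.Prime) (hp2 : p ≠ 2) :
    2 * ZsumP p [(1, 1), (1, -1), (1, 1)] + ZsumP p [(1, -1), (1, -1), (1, -1)]
      + ZsumP p [(1, -1), (1, 1), (1, -1)] = 0 := by
  have := Fact.mk hp
  have hone : (1 : ZMod p) * 1 = 1 := mul_one 1
  have hneg : (-1 : ZMod p) * -1 = 1 := by ring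
  have hlt : ∀ n, 0 < n → n < p → (n : ZMod p) ≠ 0 := fun n h h' h0 =>
    absurd (Nat.le_of_dvd h ((ZMod.natCast_eq_zero_iff n p).1 h0)) h'.not_ge
  have key := coeff_geomTail_mul_linear_shuffle (ZMod.natCast_self p) hlt hone hneg
  rw [coeff_geomTail_mul_geomInt_triple hone hneg hneg,
    coeff_geomTail_mul_geomInt_triple hneg hone hneg,
    coeff_geomTail_mul_geomInt_triple hneg hneg hone] at key
  simpa [ZsumP_triple] using key
end
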